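/- arXiv:2506.20218 — 2 statements merged into one kernel-verified Lean document; each statement's English description precedes it below -/
import Mathlib

section
/- There exist constants C4, C7, C8, C > 0 and a natural number n0 such that for all integers n ≥ n0 the following holds. Consider the h-majority process on n nodes with k ≤ n opinions (k ≥ 2, h ≥ 1) started from a configuration conf_0, and write p_i = conf_0(i)/n. If p_1 ≥ C7·(log n)/n, p_1 − p_j ≥ C8·√(p_1/n) for every j ∈ {2,…,k}, and h·p_1 ≥ C4·log n, then with probability at least 1 − 1/n there exists a round t ≤ C·log n with conf_t(1) = n, i.e., the process reaches consensus on the initial plurality opinion 1 within O(log n) rounds. -/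
open scoped BigOperators

noncomputable section

/-- The number of the `h` i.i.d. samples `ω` that are equal to opinion `i`. -/
def cnt {k h : ℕ} (ω : Fin h → Fin k) (i : Fin k) : ℕ :=
  (Finset.univ.filter fun j => ω j = i).card

/-- The probability of the event `A` under `h` i.i.d. samples drawn from the
probability vector `p` on `Fin k` (multinomial sampling). -/
def multiPr (k h : ℕ) (p : Fin k → ℝ) (A : Set (Fin h → Fin k)) : ℝ :=
  ∑ ω : Fin h → Fin k, A.indicator (fun ω => ∏ j, p (ω j)) ω

/-- The maximal number of samples received by an opinion. -/
def maxCnt {k h : ℕ} (ω : Fin h → Fin k) : ℕ :=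
  Finset.univ.sup (cnt ω)

/-- The number of opinions achieving the maximal number of samples. -/
def numMax {k h : ℕ} (ω : Fin h → Fin k) : ℕ :=
  (Finset.univ.filter fun i => cnt ω i = maxCnt ω).card

/-- The probability that opinion `i` wins the `h`-majority with uniform
tie-breaking, jointly with the event `A`:
`E[ 1_A · 1{X_i = max_l X_l} / #{l : X_l maximal} ]`. -/
def winPrOn (k h : ℕ) (p : Fin k → ℝ) (A : Set (Fin h → Fin k)) (i : Fin k) : ℝ :=
  ∑ ω : Fin h → Fin k,
    (A ∩ {ω' | cnt ω' i = maxCnt ω'}).indicator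
      (fun ω => (∏ j, p (ω j)) / (numMax ω : ℝ)) ω

/-- The probability that opinion `i` wins the `h`-majority with uniform tie-breaking. -/
def winPr (k h : ℕ) (p : Fin k → ℝ) (i : Fin k) : ℝ :=
  winPrOn k h p Set.univ i

/-- `W_{i,strict}`: opinion `i` is the unique most sampled opinion. -/
def Wstrict (k h : ℕ) (i : Fin k) : Set (Fin h → Fin k) :=
  {ω | ∀ j, j ≠ i → cnt ω j < cnt ω i}

/-- `W_{i,ties}`: opinion `i` is among the most sampled opinions. -/
def Wties (k h : ℕ) (i : Fin k) : Set (Fin h → Fin k) :=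
  {ω | ∀ j, j ≠ i → cnt ω j ≤ cnt ω i}

/-- `W_{1,2,strict}`: opinion `i₁` or opinion `i₂` is the unique most sampled opinion. -/
def W12strict (k h : ℕ) (i₁ i₂ : Fin k) : Set (Fin h → Fin k) :=
  Wstrict k h i₁ ∪ Wstrict k h i₂

/-- Opinion 1 (as an element of `Fin k`, assuming `2 ≤ k`). -/
def o₁ (k : ℕ) (hk : 2 ≤ k) : Fin k := ⟨0, by omega⟩

/-- Opinion 2 (as an element of `Fin k`, assuming `2 ≤ k`). -/
def o₂ (k : ℕ) (hk : 2 ≤ k) : Fin k := ⟨1, by omega⟩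

/-- `hitPr n k h o t c` is the probability that the `h`-majority process on the
complete graph of `n` nodes with `k` opinions, started from the configuration
`c` (with `∑ i, c i = n`), reaches consensus on opinion `o` within `t` further
rounds, i.e. the probability that `conf_s o = n` for some `0 ≤ s ≤ t`.  At every
round, given the current configuration `c`, each of the `n` nodes independently
adopts opinion `i` with probability `winPr k h (fun i => c i / n) i`; the node
choices are recorded by `σ : Fin n → Fin k` and the next configuration is
`fun i => cnt σ i`. -/
def hitPr (n k h : ℕ) (o : Fin k) : ℕ → (Fin k → ℕ) → ℝ
  | 0, c => if c o = n then 1 else 0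
  | t + 1, c =>
    if c o = n then 1
    else
      ∑ σ : Fin n → Fin k,
        (∏ v, winPr k h (fun i => (c i : ℝ) / n) (σ v)) *
          hitPr n k h o t (fun i => cnt σ i)

/-- The probability of the sample `ω` under i.i.d. draws from `p`. -/
def samplePr {k h : ℕ} (p : Fin k → ℝ) (ω : Fin h → Fin k) : ℝ := ∏ v, p (ω v)

/-- The share of the win that opinion `i` receives on the sample `ω`. -/
def winShare {k h : ℕ} (i : Fin k) (ω : Fin h → Fin k) : ℝ :=
  if cnt ω i = maxCnt ω then 1 / (numMax ω : ℝ) else 0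

lemma winPr_eq_sum (k h : ℕ) (p : Fin k → ℝ) (i : Fin k) :
    winPr k h p i = ∑ ω : Fin h → Fin k, samplePr p ω * winShare i ω := by
  unfold winPr winPrOn samplePr winShare
  refine Finset.sum_congr rfl fun ω _ => ?_
  by_cases hi : cnt ω i = maxCnt ω <;> simp [Set.indicator, hi, div_eq_mul_inv]

lemma samplePr_nonneg {k h : ℕ} {p : Fin k → ℝ} (hp : ∀ i, 0 ≤ p i) (ω : Fin h → Fin k) :
    0 ≤ samplePr p ω :=
  Finset.prod_nonneg fun v _ => hp (ω v)

lemma winShare_nonneg {k h : ℕ} (i : Fin k) (ω : Fin h → Fin k) : 0 ≤ winShare i ω := by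
  unfold winShare; split_ifs <;> positivity

lemma winShare_le_one {k h : ℕ} (i : Fin k) (ω : Fin h → Fin k) : winShare i ω ≤ 1 := by
  unfold winShare
  split_ifs with hi
  · have : 1 ≤ numMax ω := Finset.card_pos.mpr ⟨i, by simp [hi]⟩
    rw [div_le_one (by exact_mod_cast this)]
    exact_mod_cast this
  · exact zero_le_one

lemma cnt_le_maxCnt {k h : ℕ} (ω : Fin h → Fin k) (i : Fin k) : cnt ω i ≤ maxCnt ω :=
  Finset.le_sup (f := cnt ω) (Finset.mem_univ i)

lemma winShare_eq_zero_of_lt {k h : ℕ} {i j : Fin k} {ω : Fin h → Fin k}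
    (hij : cnt ω i < cnt ω j) : winShare i ω = 0 :=
  if_neg (hij.trans_le (cnt_le_maxCnt ω j)).ne

lemma winShare_eq_one {k h : ℕ} {i : Fin k} {ω : Fin h → Fin k}
    (hi : ∀ l, l ≠ i → cnt ω l < cnt ω i) : winShare i ω = 1 := by
  have hmax : maxCnt ω = cnt ω i := by
    refine le_antisymm (Finset.sup_le fun l _ => ?_) (cnt_le_maxCnt ω i)
    by_cases hl : l = i
    · rw [hl]
    · exact (hi l hl).le
  have hnum : numMax ω = 1 := by
    unfold numMax
    rw [Finset.card_eq_one]
    refine ⟨i, ?_⟩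
    ext l
    simp only [Finset.mem_filter, Finset.mem_univ, true_and, Finset.mem_singleton, hmax]
    constructor
    · intro h; by_contra hl; exact (hi l hl).ne h
    · rintro rfl; rfl
  simp [winShare, hmax, hnum]

lemma sum_winShare {k h : ℕ} (hk : 0 < k) (ω : Fin h → Fin k) : ∑ i, winShare i ω = 1 := by
  have hpos : 0 < numMax ω := by
    obtain ⟨i, -, hi⟩ := Finset.exists_mem_eq_sup (Finset.univ : Finset (Fin k))
      ⟨⟨0, hk⟩, Finset.mem_univ _⟩ (cnt ω)
    exact Finset.card_pos.mpr ⟨i, by simp [maxCnt, hi]⟩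
  unfold winShare
  rw [← Finset.sum_filter, Finset.sum_const, nsmul_eq_mul]
  change (numMax ω : ℝ) * _ = 1
  field_simp

lemma sum_samplePr_mul_prod {k : ℕ} (h : ℕ) (p f : Fin k → ℝ) :
    ∑ ω : Fin h → Fin k, samplePr p ω * ∏ v, f (ω v) = (∑ i, p i * f i) ^ h := by
  simp only [samplePr, ← Finset.prod_mul_distrib]
  rw [Finset.sum_pow']
  simp

lemma sum_samplePr {k : ℕ} (h : ℕ) {p : Fin k → ℝ} (hp1 : ∑ i, p i = 1) :
    ∑ ω : Fin h → Fin k, samplePr p ω = 1 := by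
  simpa [hp1] using sum_samplePr_mul_prod h p (fun _ => 1)

lemma pow_cnt {k h : ℕ} (x : ℝ) (ω : Fin h → Fin k) (i : Fin k) :
    x ^ cnt ω i = ∏ v, if ω v = i then x else 1 := by
  rw [Finset.prod_ite]; simp [cnt]

lemma winPr_nonneg {k h : ℕ} {p : Fin k → ℝ} (hp : ∀ i, 0 ≤ p i) (i : Fin k) :
    0 ≤ winPr k h p i := by
  rw [winPr_eq_sum]
  exact Finset.sum_nonneg fun ω _ => mul_nonneg (samplePr_nonneg hp ω) (winShare_nonneg i ω)

lemma sum_winPr {k h : ℕ} (hk : 0 < k) {p : Fin k → ℝ} (hp1 : ∑ i, p i = 1) :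
    ∑ i, winPr k h p i = 1 := by
  simp only [winPr_eq_sum]
  rw [Finset.sum_comm]
  simp only [← Finset.mul_sum, sum_winShare hk, mul_one, sum_samplePr h hp1]

/-- Exponential Markov inequality for the counts of two opinions. -/
lemma sum_samplePr_filter_le {k h : ℕ} {p : Fin k → ℝ} (hp : ∀ i, 0 ≤ p i)
    (hp1 : ∑ i, p i = 1) {i j : Fin k} (hij : i ≠ j) {x y z : ℝ} (hx : 0 < x) (hy : 0 < y)
    (E : (Fin h → Fin k) → Prop) [DecidablePred E]
    (hE : ∀ ω, E ω → z ≤ x ^ cnt ω i * y ^ cnt ω j) :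
    z * ∑ ω with E ω, samplePr p ω ≤ Real.exp (h * (p i * (x - 1) + p j * (y - 1))) := by
  have hmgf : ∑ ω : Fin h → Fin k, samplePr p ω * (x ^ cnt ω i * y ^ cnt ω j)
      = (p i * (x - 1) + p j * (y - 1) + 1) ^ h := by
    have := sum_samplePr_mul_prod h p
      (fun l => (if l = i then x else 1) * (if l = j then y else 1))
    simp only [Finset.prod_mul_distrib, ← pow_cnt] at this
    rw [this]
    congr 1
    have hterm : ∀ l, p l * ((if l = i then x else 1) * (if l = j then y else 1))
        = (if l = i then p l * (x - 1) else 0) + (if l = j then p l * (y - 1) else 0) + p l := by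
      intro l
      by_cases h1 : l = i
      · have : l ≠ j := by rw [h1]; exact hij
        simp only [h1, hij, if_true, if_false]; ring
      · by_cases h2 : l = j
        · simp only [h2, if_true, if_false, hij.symm]; ring
        · simp [h1, h2]
    rw [Finset.sum_congr rfl fun l _ => hterm l]
    simp [Finset.sum_add_distrib, hp1]
  have hbase : 0 ≤ p i * (x - 1) + p j * (y - 1) + 1 := by
    have hle : p i + p j ≤ 1 := by
      rw [← hp1, ← Finset.sum_pair hij]
      exact Finset.sum_le_sum_of_subset_of_nonneg (Finset.subset_univ _) fun l _ _ => hp l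
    nlinarith [mul_nonneg (hp i) hx.le, mul_nonneg (hp j) hy.le]
  calc z * ∑ ω with E ω, samplePr p ω
      = ∑ ω with E ω, samplePr p ω * z := by rw [← Finset.sum_mul, mul_comm]
    _ ≤ ∑ ω with E ω, samplePr p ω * (x ^ cnt ω i * y ^ cnt ω j) := by
        refine Finset.sum_le_sum fun ω hω => ?_
        exact mul_le_mul_of_nonneg_left (hE ω (Finset.mem_filter.mp hω).2)
          (samplePr_nonneg hp ω)
    _ ≤ ∑ ω : Fin h → Fin k, samplePr p ω * (x ^ cnt ω i * y ^ cnt ω j) := by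
        refine Finset.sum_le_sum_of_subset_of_nonneg (Finset.subset_univ _) fun ω _ _ => ?_
        have := samplePr_nonneg hp ω
        positivity
    _ = (p i * (x - 1) + p j * (y - 1) + 1) ^ h := hmgf
    _ ≤ Real.exp (p i * (x - 1) + p j * (y - 1)) ^ h :=
        pow_le_pow_left₀ hbase (Real.add_one_le_exp _) h
    _ = Real.exp (h * (p i * (x - 1) + p j * (y - 1))) := (Real.exp_nat_mul _ h).symm

/-- Bound on the winning probability of an opinion that is a constant factor rarer than another. -/
lemma winPr_le_exp {k h : ℕ} {p : Fin k → ℝ} (hp : ∀ i, 0 ≤ p i)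
    (hp1 : ∑ i, p i = 1) {i j : Fin k} (hij : i ≠ j) {y : ℝ} (hy : 0 < y) (hy1 : y ≤ 1)
    (hpj : p j ≤ y ^ 2 * p i) :
    winPr k h p j ≤ Real.exp (-(h * p i * (1 - y) ^ 2)) := by
  have h1 : winPr k h p j ≤ ∑ ω : Fin h → Fin k with cnt ω i ≤ cnt ω j, samplePr p ω := by
    rw [winPr_eq_sum, Finset.sum_filter]
    refine Finset.sum_le_sum fun ω _ => ?_
    split_ifs with hle
    · exact mul_le_of_le_one_right (samplePr_nonneg hp ω) (winShare_le_one j ω)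
    · rw [winShare_eq_zero_of_lt (not_le.mp hle), mul_zero]
  have h2 := sum_samplePr_filter_le (h := h) hp hp1 hij hy (inv_pos.mpr hy) (z := 1)
    (fun ω => cnt ω i ≤ cnt ω j) (fun ω hω => by
      rw [inv_pow, ← div_eq_mul_inv, one_le_div (by positivity)]
      exact pow_le_pow_of_le_one hy.le hy1 hω)
  rw [one_mul] at h2
  refine h1.trans (h2.trans (Real.exp_le_exp.mpr ?_))
  have h3 : p j * (y⁻¹ - 1) ≤ y ^ 2 * p i * (y⁻¹ - 1) :=
    mul_le_mul_of_nonneg_right hpj (by rw [sub_nonneg]; exact (one_le_inv₀ hy).mpr hy1)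
  have h4 : y ^ 2 * p i * (y⁻¹ - 1) = p i * (y - y ^ 2) := by field_simp
  have h5 : (0 : ℝ) ≤ h := Nat.cast_nonneg h
  nlinarith [mul_le_mul_of_nonneg_left (h3.trans_eq h4) h5]

/-- An opinion without supporters never wins. -/
lemma winPr_eq_zero {k h : ℕ} (hh : 1 ≤ h) {p : Fin k → ℝ} {j : Fin k} (hj : p j = 0) :
    winPr k h p j = 0 := by
  rw [winPr_eq_sum]
  refine Finset.sum_eq_zero fun ω _ => ?_
  by_cases hv : ∃ v, ω v = j
  · obtain ⟨v, hv⟩ := hv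
    rw [samplePr, Finset.prod_eq_zero (Finset.mem_univ v) (by rw [hv, hj]), zero_mul]
  · push Not at hv
    have h0 : cnt ω j = 0 := by simp [cnt, hv]
    have h1 : 0 < cnt ω (ω ⟨0, hh⟩) := Finset.card_pos.mpr ⟨⟨0, hh⟩, by simp⟩
    rw [winShare_eq_zero_of_lt (h0.trans_lt h1), mul_zero]

lemma cnt_swap {k h : ℕ} (i j : Fin k) (ω : Fin h → Fin k) (l : Fin k) :
    cnt (Equiv.swap i j ∘ ω) l = cnt ω (Equiv.swap i j l) := by
  unfold cnt
  congr 1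
  ext v
  simp [Equiv.swap_apply_eq_iff]

lemma winShare_swap {k h : ℕ} (i j : Fin k) (ω : Fin h → Fin k) :
    winShare j (Equiv.swap i j ∘ ω) = winShare i ω := by
  have hmax : maxCnt (Equiv.swap i j ∘ ω) = maxCnt ω := by
    unfold maxCnt
    refine le_antisymm (Finset.sup_le fun l _ => ?_) (Finset.sup_le fun l _ => ?_)
    · rw [cnt_swap]; exact Finset.le_sup (f := cnt ω) (Finset.mem_univ _)
    · have := Finset.le_sup (f := cnt (Equiv.swap i j ∘ ω)) (Finset.mem_univ (Equiv.swap i j l))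
      rwa [cnt_swap, Equiv.swap_apply_self] at this
  have hnum : numMax (Equiv.swap i j ∘ ω) = numMax ω := by
    unfold numMax
    simp only [hmax, cnt_swap]
    refine Finset.card_bij (fun l _ => Equiv.swap i j l) ?_ ?_ ?_
    · intro l hl; simpa using hl
    · intro a _ b _ hab; exact (Equiv.swap i j).injective hab
    · intro b hb; exact ⟨Equiv.swap i j b, by simpa using hb, by simp⟩
  simp [winShare, hmax, hnum, cnt_swap]

lemma samplePr_eq_mul {k h : ℕ} (p : Fin k → ℝ) {i j : Fin k} (hij : i ≠ j)
    (ω : Fin h → Fin k) :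
    samplePr p ω = p i ^ cnt ω i * p j ^ cnt ω j *
      ∏ v, if ω v = i ∨ ω v = j then 1 else p (ω v) := by
  rw [pow_cnt, pow_cnt, samplePr, ← Finset.prod_mul_distrib, ← Finset.prod_mul_distrib]
  refine Finset.prod_congr rfl fun v _ => ?_
  by_cases h1 : ω v = i
  · simp [h1, hij]
  · by_cases h2 : ω v = j <;> simp [h1, h2, hij.symm]

lemma samplePr_swap {k h : ℕ} {p : Fin k → ℝ} {i j : Fin k} (hij : i ≠ j) {r : ℝ}
    (hr : p j = r * p i) (ω : Fin h → Fin k) (hle : cnt ω j ≤ cnt ω i) :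
    samplePr p (Equiv.swap i j ∘ ω) = samplePr p ω * r ^ (cnt ω i - cnt ω j) := by
  rw [samplePr_eq_mul p hij, samplePr_eq_mul p hij]
  have hrest : (∏ v, if (Equiv.swap i j ∘ ω) v = i ∨ (Equiv.swap i j ∘ ω) v = j then 1
      else p ((Equiv.swap i j ∘ ω) v)) = ∏ v, if ω v = i ∨ ω v = j then 1 else p (ω v) := by
    refine Finset.prod_congr rfl fun v _ => ?_
    by_cases h1 : ω v = i
    · simp [h1]
    · by_cases h2 : ω v = j
      · simp [h2]
      · simp [h1, h2, Equiv.swap_apply_of_ne_of_ne]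
  rw [hrest, cnt_swap, cnt_swap, Equiv.swap_apply_left, Equiv.swap_apply_right, hr]
  obtain ⟨g, hg⟩ := Nat.exists_eq_add_of_le hle
  rw [hg, Nat.add_sub_cancel_left]
  ring

/-- The winning probability of `j` as a reweighting of the wins of `i`. -/
lemma winPr_eq_sum_swap {k h : ℕ} {p : Fin k → ℝ} {i j : Fin k} (hij : i ≠ j) {r : ℝ}
    (hr : p j = r * p i) :
    winPr k h p j =
      ∑ ω : Fin h → Fin k, samplePr p ω * winShare i ω * r ^ (cnt ω i - cnt ω j) := by
  rw [winPr_eq_sum, ← Equiv.sum_comp (Equiv.arrowCongr (Equiv.refl (Fin h)) (Equiv.swap i j))]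
  refine Finset.sum_congr rfl fun ω _ => ?_
  have : Equiv.arrowCongr (Equiv.refl (Fin h)) (Equiv.swap i j) ω = Equiv.swap i j ∘ ω := rfl
  rw [this, winShare_swap]
  rcases le_or_gt (cnt ω j) (cnt ω i) with hle | hlt
  · rw [samplePr_swap hij hr ω hle]; ring
  · rw [winShare_eq_zero_of_lt hlt]; ring

lemma winPr_le_winPr {k h : ℕ} {p : Fin k → ℝ} (hp : ∀ i, 0 ≤ p i) {i j : Fin k} (hij : i ≠ j)
    {r : ℝ} (hr : p j = r * p i) (hr0 : 0 ≤ r) (hr1 : r ≤ 1) :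
    winPr k h p j ≤ winPr k h p i := by
  rw [winPr_eq_sum_swap hij hr, winPr_eq_sum]
  exact Finset.sum_le_sum fun ω _ => mul_le_of_le_one_right
    (mul_nonneg (samplePr_nonneg hp ω) (winShare_nonneg i ω)) (pow_le_one₀ hr0 hr1)

lemma cnt_update_self {k h : ℕ} {i : Fin k} {ω : Fin h → Fin k} {v : Fin h} (hv : ω v ≠ i) :
    cnt (Function.update ω v i) i = cnt ω i + 1 := by
  unfold cnt
  rw [← Finset.card_insert_of_notMem (s := Finset.univ.filter fun j => ω j = i) (a := v)
    (by simp [hv])]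
  congr 1
  ext u
  by_cases hu : u = v
  · subst hu; simp
  · simp [hu]

lemma cnt_update_source {k h : ℕ} {i j : Fin k} (hij : i ≠ j) {ω : Fin h → Fin k} {v : Fin h}
    (hv : ω v = j) : cnt (Function.update ω v i) j + 1 = cnt ω j := by
  have h1 : Function.update (Function.update ω v i) v j = ω := by
    rw [Function.update_idem, ← hv, Function.update_eq_self]
  have h2 := cnt_update_self (i := j) (ω := Function.update ω v i) (v := v) (by simpa using hij)
  rw [h1] at h2
  exact h2.symm

lemma cnt_update_le {k h : ℕ} {i l : Fin k} (hl : l ≠ i) (ω : Fin h → Fin k) (v : Fin h) :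
    cnt (Function.update ω v i) l ≤ cnt ω l := by
  unfold cnt
  refine Finset.card_le_card fun u hu => ?_
  by_cases huv : u = v
  · subst huv; simp [hl.symm] at hu
  · simpa [huv] using hu

lemma winShare_le_update {k h : ℕ} {i : Fin k} {ω : Fin h → Fin k} {v : Fin h} (hv : ω v ≠ i) :
    winShare i ω ≤ winShare i (Function.update ω v i) := by
  by_cases hmax : cnt ω i = maxCnt ω
  · rw [winShare_eq_one (ω := Function.update ω v i) fun l hl => ?_]
    · exact winShare_le_one i ω
    · rw [cnt_update_self hv, Nat.lt_succ_iff, hmax]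
      exact (cnt_update_le hl ω v).trans (cnt_le_maxCnt ω l)
  · rw [winShare, if_neg hmax]; exact winShare_nonneg _ _

lemma samplePr_le_update {k h : ℕ} {p : Fin k → ℝ} (hp : ∀ i, 0 ≤ p i) {i j : Fin k}
    (hle : p j ≤ p i) {ω : Fin h → Fin k} {v : Fin h} (hv : ω v = j) :
    samplePr p ω ≤ samplePr p (Function.update ω v i) := by
  refine Finset.prod_le_prod (fun u _ => hp _) fun u _ => ?_
  by_cases huv : u = v
  · subst huv; simpa [hv] using hle
  · simp [huv]

/-- Moving one vote from `j` to `i`: the winning mass of a set of samples with at least a fraction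
`q` of possible moves is dominated by the winning mass of the samples reached. -/
lemma sum_winShare_shift_le {k h : ℕ} {p : Fin k → ℝ} (hp : ∀ i, 0 ≤ p i) {i j : Fin k}
    (hij : i ≠ j) (hle : p j ≤ p i) {q : ℝ} (S T : (Fin h → Fin k) → Prop)
    [DecidablePred S] [DecidablePred T]
    (hq : ∀ ω, S ω → q * (cnt ω i + 1) ≤ cnt ω j)
    (hST : ∀ ω v, S ω → ω v = j → T (Function.update ω v i)) :
    q * ∑ ω with S ω, samplePr p ω * winShare i ω ≤
      ∑ ω with T ω, samplePr p ω * winShare i ω := by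
  have hnn : ∀ ω : Fin h → Fin k, 0 ≤ samplePr p ω * winShare i ω := fun ω =>
    mul_nonneg (samplePr_nonneg hp ω) (winShare_nonneg i ω)
  calc q * ∑ ω with S ω, samplePr p ω * winShare i ω
      ≤ ∑ ω with S ω, ∑ v with ω v = j, samplePr p ω * winShare i ω / (cnt ω i + 1) := by
        rw [Finset.mul_sum]
        refine Finset.sum_le_sum fun ω hω => ?_
        rw [Finset.sum_const, nsmul_eq_mul]
        change _ ≤ (cnt ω j : ℝ) * _
        have h1 := hq ω (Finset.mem_filter.mp hω).2
        have h2 : (0 : ℝ) < cnt ω i + 1 := by positivity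
        rw [mul_div_assoc', le_div_iff₀ h2]
        nlinarith [mul_le_mul_of_nonneg_right h1 (hnn ω)]
    _ = ∑ v, ∑ ω with S ω ∧ ω v = j, samplePr p ω * winShare i ω / (cnt ω i + 1) := by
        simp only [Finset.sum_filter, ite_and]
        rw [Finset.sum_comm]
        refine Finset.sum_congr rfl fun ω _ => ?_
        by_cases hS : S ω <;> simp [hS]
    _ ≤ ∑ v, ∑ ω with T ω ∧ ω v = i, samplePr p ω * winShare i ω / cnt ω i := by
        refine Finset.sum_le_sum fun v _ => ?_
        have hinj : Set.InjOn (fun ω : Fin h → Fin k => Function.update ω v i)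
            ↑(Finset.univ.filter fun ω : Fin h → Fin k => S ω ∧ ω v = j) := by
          intro a ha b hb hab
          have ha' : a v = j := by simpa using (Finset.mem_filter.mp ha).2.2
          have hb' : b v = j := by simpa using (Finset.mem_filter.mp hb).2.2
          funext u
          by_cases huv : u = v
          · rw [huv, ha', hb']
          · simpa [huv] using congrFun hab u
        calc _ ≤ ∑ ω with S ω ∧ ω v = j, samplePr p (Function.update ω v i) *
                winShare i (Function.update ω v i) / cnt (Function.update ω v i) i := by
              refine Finset.sum_le_sum fun ω hω => ?_
              obtain ⟨-, -, hv⟩ := Finset.mem_filter.mp hω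
              have hvi : ω v ≠ i := by rw [hv]; exact hij.symm
              rw [cnt_update_self hvi]
              push_cast
              refine div_le_div_of_nonneg_right ?_ (by positivity)
              exact mul_le_mul (samplePr_le_update hp hle hv) (winShare_le_update hvi)
                (winShare_nonneg _ _) (samplePr_nonneg hp _)
          _ = ∑ ω ∈ (Finset.univ.filter fun ω : Fin h → Fin k => S ω ∧ ω v = j).image
                (fun ω => Function.update ω v i),
                samplePr p ω * winShare i ω / cnt ω i := by
              rw [Finset.sum_image hinj]
          _ ≤ _ := by
              refine Finset.sum_le_sum_of_subset_of_nonneg ?_ fun ω _ _ =>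
                div_nonneg (hnn ω) (Nat.cast_nonneg _)
              intro ω' hω'
              obtain ⟨ω, hω, rfl⟩ := Finset.mem_image.mp hω'
              obtain ⟨-, hS, hv⟩ := Finset.mem_filter.mp hω
              simpa using hST ω v hS hv
    _ = ∑ ω with T ω, ∑ v with ω v = i, samplePr p ω * winShare i ω / cnt ω i := by
        simp only [Finset.sum_filter, ite_and]
        rw [Finset.sum_comm]
        refine Finset.sum_congr rfl fun ω _ => ?_
        by_cases hT : T ω <;> simp [hT]
    _ ≤ ∑ ω with T ω, samplePr p ω * winShare i ω := by
        refine Finset.sum_le_sum fun ω _ => ?_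
        rw [Finset.sum_const, nsmul_eq_mul]
        change (cnt ω i : ℝ) * _ ≤ _
        rcases Nat.eq_zero_or_pos (cnt ω i) with h0 | h0
        · simpa [h0] using hnn ω
        · have : (0 : ℝ) < cnt ω i := by exact_mod_cast h0
          rw [mul_div_cancel₀ _ this.ne']

/-- The mass of wins of `i` with a lead over `j` in `[0, 2ℓ)` is, up to a constant factor, at most
the mass of those with a lead in `[2ℓ, 4ℓ)`. -/
lemma sum_winShare_window_le {k h : ℕ} {p : Fin k → ℝ} (hp : ∀ i, 0 ≤ p i) {i j : Fin k}
    (hij : i ≠ j) (hle : p j ≤ p i) {ℓ : ℕ} {m η : ℝ} (hm : η * m = 8 * ℓ) (hη0 : 0 ≤ η)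
    (hη : η ≤ 1) {s : ℕ} (hs : s ≤ ℓ) :
    (1 - η) ^ s * ∑ ω : Fin h → Fin k with m ≤ cnt ω i + cnt ω j ∧ cnt ω j ≤ cnt ω i ∧
        cnt ω i < cnt ω j + 2 * ℓ, samplePr p ω * winShare i ω ≤
      ∑ ω : Fin h → Fin k with m ≤ cnt ω i + cnt ω j ∧ cnt ω j + 2 * s ≤ cnt ω i ∧
        cnt ω i < cnt ω j + 2 * s + 2 * ℓ, samplePr p ω * winShare i ω := by
  induction s with
  | zero => simp
  | succ s ih =>
    have ih := ih (by omega)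
    rw [pow_succ', mul_assoc]
    refine (mul_le_mul_of_nonneg_left ih (sub_nonneg.mpr hη)).trans ?_
    refine sum_winShare_shift_le hp hij hle _ _ ?_ ?_
    · rintro ω ⟨h1, h2, h3⟩
      have h3' : (cnt ω i : ℝ) + 3 ≤ cnt ω j + 4 * ℓ := by
        have : cnt ω i + 3 ≤ cnt ω j + 4 * ℓ := by omega
        exact_mod_cast this
      have h2' : (cnt ω j : ℝ) ≤ cnt ω i := by
        have : cnt ω j ≤ cnt ω i := by omega
        exact_mod_cast this
      nlinarith [mul_le_mul_of_nonneg_left (show m ≤ 2 * (cnt ω i + 1) by linarith) hη0]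
    · rintro ω v ⟨h1, h2, h3⟩ hv
      have h4 := cnt_update_self (i := i) (ω := ω) (v := v) (by rw [hv]; exact hij.symm)
      have h5 := cnt_update_source hij hv
      refine ⟨?_, by omega, by omega⟩
      have h5' : (cnt (Function.update ω v i) j : ℝ) + 1 = cnt ω j := by exact_mod_cast h5
      rw [h4]
      push_cast
      linarith

/-- Amplification of a small bias by one round. -/
lemma winPr_le_of_close {k h : ℕ} {p : Fin k → ℝ} (hp : ∀ i, 0 ≤ p i) (hp1 : ∑ i, p i = 1)
    {i j : Fin k} (hij : i ≠ j) {r : ℝ} (hr : p j = r * p i) (hr0 : 0 ≤ r) (hr1 : r ≤ 1)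
    {ℓ : ℕ} (hℓ : 1 ≤ ℓ) (hlam : 80 * (ℓ : ℝ) ^ 2 ≤ h * p i)
    (htail : Real.exp (-(h * p i / 4)) ≤ winPr k h p i / 4) :
    winPr k h p j ≤ winPr k h p i * (1 - (1 - r ^ (2 * ℓ)) / 4) := by
  have hle : p j ≤ p i := by rw [hr]; exact mul_le_of_le_one_left (hp i) hr1
  have hℓ' : (1 : ℝ) ≤ ℓ := by exact_mod_cast hℓ
  set lam : ℝ := h * p i with hlamdef
  have hlam0 : 0 < lam := by nlinarith
  set m : ℝ := lam / 4 with hmdef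
  have hm0 : 0 < m := by positivity
  set F : (Fin h → Fin k) → ℝ := fun ω => samplePr p ω * winShare i ω with hF
  have hnn : ∀ ω, 0 ≤ F ω := fun ω => mul_nonneg (samplePr_nonneg hp ω) (winShare_nonneg i ω)
  set Low := ∑ ω : Fin h → Fin k with m ≤ cnt ω i + cnt ω j ∧ cnt ω j ≤ cnt ω i ∧
        cnt ω i < cnt ω j + 2 * ℓ, F ω with hLow
  set B := ∑ ω : Fin h → Fin k with m ≤ cnt ω i + cnt ω j ∧ cnt ω j + 2 * ℓ ≤ cnt ω i, F ω with hB
  have hLowB : Low ≤ 2 * B := by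
    have hη1 : 8 * ℓ / m * ℓ ≤ 1 / 2 := by
      rw [div_mul_eq_mul_div, div_le_iff₀ hm0]
      nlinarith
    have hη0 : 0 ≤ 8 * ℓ / m := by positivity
    have hη2 : 8 * ℓ / m ≤ 1 := by nlinarith
    have h1 := sum_winShare_window_le (h := h) hp hij hle (ℓ := ℓ) (m := m) (η := 8 * ℓ / m)
      (by field_simp) hη0 hη2 le_rfl
    have h2 : (1 : ℝ) / 2 ≤ (1 - 8 * ℓ / m) ^ ℓ := by
      have := one_add_mul_le_pow (a := -(8 * (ℓ : ℝ) / m)) (by linarith) ℓ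
      rw [← sub_eq_add_neg] at this
      linarith
    have h3 : ∑ ω : Fin h → Fin k with m ≤ cnt ω i + cnt ω j ∧ cnt ω j + 2 * ℓ ≤ cnt ω i ∧
        cnt ω i < cnt ω j + 2 * ℓ + 2 * ℓ, F ω ≤ B := by
      refine Finset.sum_le_sum_of_subset_of_nonneg ?_ fun ω _ _ => hnn ω
      intro ω hω
      simp only [Finset.mem_filter, Finset.mem_univ, true_and] at hω ⊢
      exact ⟨hω.1, hω.2.1⟩
    have h4 : 0 ≤ Low := Finset.sum_nonneg fun ω _ => hnn ω
    have h5 := h1.trans h3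
    change (1 - 8 * ℓ / m) ^ ℓ * Low ≤ B at h5
    nlinarith [mul_le_mul_of_nonneg_right h2 h4]
  set R := ∑ ω : Fin h → Fin k with (cnt ω i + cnt ω j : ℝ) < m, samplePr p ω with hR
  have hRle : R ≤ winPr k h p i / 4 := by
    refine le_trans ?_ htail
    have h1 := sum_samplePr_filter_le (h := h) hp hp1 hij (Real.exp_pos (-1)) one_pos
      (z := Real.exp (-m)) (fun ω => (cnt ω i + cnt ω j : ℝ) < m) (fun ω hω => by
        rw [one_pow, mul_one, ← Real.exp_nat_mul]
        refine Real.exp_le_exp.mpr ?_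
        have : (0 : ℝ) ≤ cnt ω j := Nat.cast_nonneg _
        linarith)
    have h2 : Real.exp (-1) ≤ 1 / 2 := by
      rw [Real.exp_neg, one_div]
      exact inv_anti₀ two_pos (by have := Real.add_one_le_exp (1 : ℝ); linarith)
    have h3 : Real.exp (h * (p i * (Real.exp (-1) - 1) + p j * (1 - 1))) ≤
        Real.exp (-m) * Real.exp (-(lam / 4)) := by
      rw [← Real.exp_add]
      refine Real.exp_le_exp.mpr ?_
      have : (h : ℝ) * (p i * (Real.exp (-1) - 1) + p j * (1 - 1)) = lam * (Real.exp (-1) - 1) := by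
        rw [hlamdef]; ring
      rw [this]
      nlinarith
    exact le_of_mul_le_mul_left (h1.trans h3) (Real.exp_pos _)
  have hwi : winPr k h p i ≤ Low + B + R := by
    rw [winPr_eq_sum, hLow, hB, hR, Finset.sum_filter, Finset.sum_filter, Finset.sum_filter,
      ← Finset.sum_add_distrib, ← Finset.sum_add_distrib]
    refine Finset.sum_le_sum fun ω _ => ?_
    change F ω ≤ _
    have hs := samplePr_nonneg hp ω
    have hFs : F ω ≤ samplePr p ω := mul_le_of_le_one_right hs (winShare_le_one i ω)
    have hF0 := hnn ω
    rcases lt_or_ge (cnt ω i + cnt ω j : ℝ) m with h1 | h1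
    · rw [if_pos h1]; split_ifs <;> linarith
    · rcases lt_or_ge (cnt ω i) (cnt ω j) with h2 | h2
      · have : F ω = 0 := by simp only [hF]; rw [winShare_eq_zero_of_lt h2, mul_zero]
        rw [this]; split_ifs <;> linarith
      · rcases lt_or_ge (cnt ω i) (cnt ω j + 2 * ℓ) with h3 | h3
        · rw [if_pos ⟨h1, h2, h3⟩]; split_ifs <;> linarith
        · rw [if_pos (c := _ ∧ cnt ω j + 2 * ℓ ≤ cnt ω i) ⟨h1, h3⟩]; split_ifs <;> linarith
  have hwj : winPr k h p j ≤ winPr k h p i - (1 - r ^ (2 * ℓ)) * B := by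
    rw [winPr_eq_sum_swap hij hr, winPr_eq_sum, hB, Finset.mul_sum, Finset.sum_filter,
      ← Finset.sum_sub_distrib]
    refine Finset.sum_le_sum fun ω _ => ?_
    change F ω * _ ≤ F ω - _
    have hF0 := hnn ω
    split_ifs with hω
    · have : r ^ (cnt ω i - cnt ω j) ≤ r ^ (2 * ℓ) := pow_le_pow_of_le_one hr0 hr1 (by omega)
      nlinarith [mul_le_mul_of_nonneg_left this hF0]
    · rw [sub_zero]; exact mul_le_of_le_one_right hF0 (pow_le_one₀ hr0 hr1)
  have hBw : winPr k h p i / 4 ≤ B := by linarith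
  have hrl : 0 ≤ 1 - r ^ (2 * ℓ) := sub_nonneg.mpr (pow_le_one₀ hr0 hr1)
  nlinarith [mul_le_mul_of_nonneg_left hBw hrl]

lemma half_min_le_one_sub_pow {s : ℝ} (hs0 : 0 ≤ s) (hs1 : s ≤ 1) (L : ℕ) :
    min (L * s) 1 / 2 ≤ 1 - (1 - s) ^ L := by
  have h1 : (1 - s) ^ L * (1 + L * s) ≤ 1 := by
    calc (1 - s) ^ L * (1 + L * s) ≤ (1 - s) ^ L * (1 + s) ^ L := by
          refine mul_le_mul_of_nonneg_left ?_ (pow_nonneg (by linarith) L)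
          exact one_add_mul_le_pow (by linarith) L
      _ = (1 - s ^ 2) ^ L := by rw [← mul_pow]; ring
      _ ≤ 1 := pow_le_one₀ (by nlinarith) (by nlinarith)
  have h2 : 0 ≤ (1 - s) ^ L := pow_nonneg (by linarith) L
  have h3 : 0 ≤ min (L * s) 1 := le_min (by positivity) zero_le_one
  have h4 : min (L * s) 1 ≤ L * s := min_le_left _ _
  have h5 : min (L * s) 1 ≤ 1 := min_le_right _ _
  have h6 : (1 - s) ^ L * (1 + min (L * s) 1) ≤ 1 :=
    (mul_le_mul_of_nonneg_left (by linarith) h2).trans h1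
  nlinarith

lemma one_le_mul_winPr {k h : ℕ} {p : Fin k → ℝ} (hp : ∀ i, 0 ≤ p i) (hp1 : ∑ i, p i = 1)
    {o : Fin k} (ho : 0 < p o) (hmax : ∀ j, j ≠ o → p j ≤ p o) :
    1 ≤ k * winPr k h p o := by
  have hk : 0 < k := o.pos
  rw [← sum_winPr (h := h) hk hp1]
  refine (Finset.sum_le_card_nsmul Finset.univ _ (winPr k h p o) fun j _ => ?_).trans_eq (by simp)
  by_cases hj : j = o
  · rw [hj]
  · exact winPr_le_winPr hp (Ne.symm hj) (r := p j / p o) (by field_simp)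
      (div_nonneg (hp j) ho.le) ((div_le_one ho).mpr (hmax j hj))

/-- One round amplifies every relative bias towards the plurality opinion `o`. -/
lemma winPr_mul_le {n k h : ℕ} (hn : 2 ≤ n) (hkn : k ≤ n) (hh : 1 ≤ h) {p : Fin k → ℝ}
    (hp : ∀ i, 0 ≤ p i) (hp1 : ∑ i, p i = 1) {o : Fin k} (ho : 0 < p o)
    (hpn : ∀ i, p i = 0 ∨ 1 / (n : ℝ) ≤ p i) {ℓ : ℕ} (hℓ : 16 ≤ ℓ)
    (hlam : 80 * (ℓ : ℝ) ^ 2 ≤ h * p o)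
    (hexp : Real.exp (-(h * p o / 4096)) ≤ 1 / (n : ℝ) ^ 5)
    {δ : ℝ} (hδ0 : 0 ≤ δ) (hδ : ∀ j, j ≠ o → p j ≤ (1 - δ) * p o) {j : Fin k} (hj : j ≠ o) :
    winPr k h p j ≤ (1 - min (2 * ℓ * δ) 1 / 16) * (p j / p o) * winPr k h p o := by
  have hn' : (2 : ℝ) ≤ n := by exact_mod_cast hn
  have hmax : ∀ j, j ≠ o → p j ≤ p o := fun j hj => (hδ j hj).trans (by nlinarith)
  have hwo : 1 / (n : ℝ) ≤ winPr k h p o := by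
    have h1 := one_le_mul_winPr (h := h) hp hp1 ho hmax
    have h2 : (k : ℝ) ≤ n := by exact_mod_cast hkn
    rw [div_le_iff₀ (by linarith)]
    nlinarith [winPr_nonneg (h := h) hp o]
  set r := p j / p o with hrdef
  have hr : p j = r * p o := by rw [hrdef]; field_simp
  have hr0 : 0 ≤ r := div_nonneg (hp j) ho.le
  have hrδ : r ≤ 1 - δ := (div_le_iff₀ ho).mpr (hδ j hj)
  have hr1 : r ≤ 1 := by linarith
  have hwo0 := winPr_nonneg (h := h) hp o
  set D := min (2 * (ℓ : ℝ) * δ) 1 / 16 with hD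
  have hD1 : D ≤ 1 / 16 := by rw [hD]; linarith [min_le_right (2 * (ℓ : ℝ) * δ) 1]
  rcases hpn j with h0 | hjn
  · rw [winPr_eq_zero hh h0]
    exact mul_nonneg (mul_nonneg (by linarith) hr0) hwo0
  rcases le_or_gt r (15 / 16) with hfar | hclose
  · have h1 : winPr k h p j ≤ 1 / (n : ℝ) ^ 5 := by
      refine le_trans ?_ hexp
      refine (winPr_le_exp hp hp1 hj.symm (y := 63 / 64) (by norm_num) (by norm_num) ?_).trans_eq
        (by congr 1; ring)
      rw [hr]
      exact mul_le_mul_of_nonneg_right (hfar.trans (by norm_num)) ho.le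
    have hpo1 : p o ≤ 1 := by
      rw [← hp1]; exact Finset.single_le_sum (fun i _ => hp i) (Finset.mem_univ o)
    have hrn : 1 / (n : ℝ) ≤ r := by
      refine hjn.trans ?_
      rw [hr]; exact mul_le_of_le_one_right hr0 hpo1
    have hn0 : 0 ≤ 1 / (n : ℝ) := by positivity
    have h2 : 1 / (n : ℝ) ^ 5 ≤ 1 / 2 * (1 / n) * (1 / n) := by
      have h3 : (1 / (n : ℝ)) ≤ 1 / 2 := one_div_le_one_div_of_le two_pos hn'
      have h4 : (1 / (n : ℝ)) ^ 3 ≤ (1 / 2) ^ 3 := pow_le_pow_left₀ hn0 h3 3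
      have h5 : 1 / (n : ℝ) ^ 5 = (1 / (n : ℝ)) ^ 3 * (1 / n) * (1 / n) := by
        field_simp
      rw [h5]
      gcongr
      exact h4.trans (by norm_num)
    refine h1.trans (h2.trans ?_)
    have : 1 / 2 * (1 / (n : ℝ)) ≤ (1 - D) * r := by
      exact mul_le_mul (by linarith) hrn hn0 (by linarith)
    exact mul_le_mul this hwo hn0 (mul_nonneg (by linarith) hr0)
  · have htail : Real.exp (-(h * p o / 4)) ≤ winPr k h p o / 4 := by
      have h1 : Real.exp (-(h * p o / 4)) ≤ 1 / (n : ℝ) ^ 5 := by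
        refine le_trans (Real.exp_le_exp.mpr ?_) hexp
        have : 0 ≤ h * p o := by positivity
        linarith
      have h2 : 1 / (n : ℝ) ^ 5 ≤ 1 / n / 4 := by
        rw [div_div]
        refine one_div_le_one_div_of_le (by positivity) ?_
        have : (2 : ℝ) ^ 4 ≤ (n : ℝ) ^ 4 := pow_le_pow_left₀ (by norm_num) hn' 4
        nlinarith
      linarith
    have h1 := winPr_le_of_close hp hp1 hj.symm hr hr0 hr1 (by omega) hlam htail
    have h2 := half_min_le_one_sub_pow (s := 1 - r) (by linarith) (by linarith) (2 * ℓ)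
    rw [sub_sub_cancel] at h2
    push_cast at h2
    have h3 : D * 16 ≤ min (2 * ℓ * (1 - r)) 1 := by
      rw [hD, div_mul_cancel₀ _ (by norm_num)]
      refine min_le_min_right _ ?_
      exact mul_le_mul_of_nonneg_left (by linarith) (by positivity)
    have h4 : 16 * (1 - r) ≤ min (2 * ℓ * (1 - r)) 1 := by
      have : (16 : ℝ) ≤ ℓ := by exact_mod_cast hℓ
      refine le_min (mul_le_mul_of_nonneg_right (by linarith) (by linarith)) (by linarith)
    have hD0 : 0 ≤ D := by rw [hD]; positivity
    have h5 : 1 - (1 - r ^ (2 * ℓ)) / 4 ≤ (1 - D) * r := by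
      nlinarith [mul_nonneg hD0 (by linarith : 0 ≤ 1 - r)]
    calc winPr k h p j ≤ winPr k h p o * (1 - (1 - r ^ (2 * ℓ)) / 4) := h1
      _ ≤ winPr k h p o * ((1 - D) * r) := mul_le_mul_of_nonneg_left h5 hwo0
      _ = _ := by ring

/-- Growth of the plurality opinion in expectation. -/
lemma mul_le_winPr {k h : ℕ} {p : Fin k → ℝ} (hp1 : ∑ i, p i = 1) {o : Fin k} {α D : ℝ}
    (hα0 : 0 < α) (hα : α ≤ 1 / 2) (hαp : α ≤ p o) (hD0 : 0 ≤ D) (hD1 : D ≤ 1)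
    (hw : ∀ j, j ≠ o → winPr k h p j ≤ (1 - D) * (p j / p o) * winPr k h p o)
    (hw0 : 0 ≤ winPr k h p o) :
    α * (1 + D / 2) ≤ winPr k h p o := by
  have ho : 0 < p o := hα0.trans_le hαp
  have h1 : 1 - winPr k h p o ≤ (1 - D) * ((1 - p o) / p o) * winPr k h p o := by
    have hsum : ∑ j ∈ Finset.univ.erase o, winPr k h p j = 1 - winPr k h p o := by
      rw [← sum_winPr (h := h) o.pos hp1, ← Finset.add_sum_erase _ _ (Finset.mem_univ o)]; ring
    have hpsum : ∑ j ∈ Finset.univ.erase o, p j = 1 - p o := by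
      rw [← hp1, ← Finset.add_sum_erase _ _ (Finset.mem_univ o)]; ring
    rw [← hsum, ← hpsum, Finset.sum_div, Finset.mul_sum, Finset.sum_mul]
    exact Finset.sum_le_sum fun j hj => hw j (Finset.ne_of_mem_erase hj)
  set w := winPr k h p o
  have h2 : p o ≤ w * (1 - D * (1 - p o)) := by
    have : (1 - D) * ((1 - p o) / p o) * w * p o = (1 - D) * (1 - p o) * w := by field_simp
    nlinarith [mul_le_mul_of_nonneg_right h1 ho.le]
  have h3 : α * (1 - D * (1 - p o)) ≤ p o * (1 - D / 2) := by
    have h4 : D * α ≤ D * (1 / 2) := mul_le_mul_of_nonneg_left hα hD0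
    nlinarith [mul_nonneg (mul_nonneg hD0 ho.le) (by linarith : (0 : ℝ) ≤ 1 / 2 - α),
      mul_nonneg (sub_nonneg.mpr hαp) (by linarith : 0 ≤ 1 - D)]
  have hX : 0 < 1 - D * (1 - p o) := by
    nlinarith [mul_nonneg hD0 ho.le]
  have h5 : α ≤ w * (1 - D / 2) := by
    have : α * (1 - D * (1 - p o)) ≤ (w * (1 - D / 2)) * (1 - D * (1 - p o)) := by
      refine h3.trans ((mul_le_mul_of_nonneg_right h2 (by linarith)).trans_eq (by ring))
    exact le_of_mul_le_mul_right this hX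
  calc α * (1 + D / 2) ≤ w * (1 - D / 2) * (1 + D / 2) :=
        mul_le_mul_of_nonneg_right h5 (by linarith)
    _ = w * (1 - (D / 2) ^ 2) := by ring
    _ ≤ w := mul_le_of_le_one_right hw0 (by nlinarith [sq_nonneg (D / 2)])

lemma sum_samplePr_lower_tail {k n : ℕ} {w : Fin k → ℝ} (hw : ∀ i, 0 ≤ w i)
    (hw1 : ∑ i, w i = 1) {i j : Fin k} (hij : i ≠ j) {ε : ℝ} (hε0 : 0 ≤ ε) (hε1 : ε ≤ 1) :
    ∑ σ : Fin n → Fin k with (cnt σ i : ℝ) < n * w i * (1 - ε), samplePr w σ ≤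
      Real.exp (-(n * w i * ε ^ 2 / 4)) := by
  have h1 := sum_samplePr_filter_le (h := n) hw hw1 hij (Real.exp_pos (-(ε / 2))) one_pos
    (z := Real.exp (-(ε / 2) * (n * w i * (1 - ε))))
    (fun σ => (cnt σ i : ℝ) < n * w i * (1 - ε)) (fun σ hσ => by
      rw [one_pow, mul_one, ← Real.exp_nat_mul]
      refine Real.exp_le_exp.mpr ?_
      nlinarith)
  have h2 : Real.exp (-(ε / 2)) - 1 ≤ -(ε / 2) + (ε / 2) ^ 2 := by
    have := (abs_le.mp (Real.abs_exp_sub_one_sub_id_le (x := -(ε / 2))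
      (by rw [abs_neg, abs_of_nonneg (by linarith)]; linarith))).2
    rw [neg_sq] at this
    linarith
  have h3 : (0 : ℝ) ≤ n * w i := mul_nonneg (Nat.cast_nonneg n) (hw i)
  refine le_of_mul_le_mul_left (h1.trans ?_) (Real.exp_pos (-(ε / 2) * (n * w i * (1 - ε))))
  rw [← Real.exp_add]
  refine Real.exp_le_exp.mpr ?_
  nlinarith [mul_le_mul_of_nonneg_left h2 h3]

lemma sum_samplePr_upper_tail {k n : ℕ} {w : Fin k → ℝ} (hw : ∀ i, 0 ≤ w i)
    (hw1 : ∑ i, w i = 1) {i j : Fin k} (hij : i ≠ j) {ε M : ℝ} (hM : w i ≤ M) (hε0 : 0 ≤ ε)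
    (hε1 : ε ≤ 1) :
    ∑ σ : Fin n → Fin k with n * w i + n * M * ε < (cnt σ i : ℝ), samplePr w σ ≤
      Real.exp (-(n * M * ε ^ 2 / 4)) := by
  have h1 := sum_samplePr_filter_le (h := n) hw hw1 hij (Real.exp_pos (ε / 2)) one_pos
    (z := Real.exp (ε / 2 * (n * w i + n * M * ε)))
    (fun σ => n * w i + n * M * ε < (cnt σ i : ℝ)) (fun σ hσ => by
      rw [one_pow, mul_one, ← Real.exp_nat_mul]
      refine Real.exp_le_exp.mpr ?_
      nlinarith)
  have h2 : Real.exp (ε / 2) - 1 ≤ ε / 2 + (ε / 2) ^ 2 := by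
    have := (abs_le.mp (Real.abs_exp_sub_one_sub_id_le (x := ε / 2)
      (by rw [abs_of_nonneg (by linarith)]; linarith))).2
    linarith
  have h3 : (0 : ℝ) ≤ n * w i := mul_nonneg (Nat.cast_nonneg n) (hw i)
  have h4 : (n : ℝ) * w i ≤ n * M := mul_le_mul_of_nonneg_left hM (Nat.cast_nonneg n)
  refine le_of_mul_le_mul_left (h1.trans ?_) (Real.exp_pos (ε / 2 * (n * w i + n * M * ε)))
  rw [← Real.exp_add]
  refine Real.exp_le_exp.mpr ?_
  nlinarith [mul_le_mul_of_nonneg_left h2 h3, mul_le_mul_of_nonneg_right h4 (sq_nonneg (ε / 2))]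

lemma exp_neg_mul_log (m : ℕ) {n : ℕ} (hn : 0 < n) :
    Real.exp (-(m * Real.log n)) = 1 / (n : ℝ) ^ m := by
  rw [Real.exp_neg, Real.exp_nat_mul, Real.exp_log (by exact_mod_cast hn), one_div]

/-- The configuration `c` has at least `A` supporters of `o`, and every other opinion is smaller by
a relative margin `δ`. -/
def Leads {k : ℕ} (o : Fin k) (A δ : ℝ) (c : Fin k → ℕ) : Prop :=
  A ≤ c o ∧ ∀ j, j ≠ o → (c j : ℝ) ≤ (1 - δ) * c o

/-- Concentration of one round around its expectation. -/
lemma sum_samplePr_not_leads_le {k n : ℕ} (hk : 2 ≤ k) (hkn : k ≤ n) {w : Fin k → ℝ}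
    (hw : ∀ i, 0 ≤ w i) (hw1 : ∑ i, w i = 1) {o : Fin k} {A D ε δ : ℝ} (hA : 0 ≤ A)
    (hwj : ∀ j, j ≠ o → w j ≤ (1 - D) * w o) (hwo : A * (1 + D / 2) ≤ n * w o)
    (hε0 : 0 ≤ ε) (hεD : 4 * ε ≤ D) (hD : D ≤ 1 / 16) (hlog : 16 * Real.log n ≤ ε ^ 2 * A)
    (hδ : δ ≤ D / 2) [DecidablePred fun σ : Fin n → Fin k => ¬ Leads o A δ (cnt σ)] :
    ∑ σ : Fin n → Fin k with ¬ Leads o A δ (cnt σ), samplePr w σ ≤ 1 / (n : ℝ) ^ 3 := by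
  classical
  have hn : 0 < n := by omega
  set W : ℝ := n * w o with hW
  have hAW : A ≤ W := le_trans (by nlinarith) hwo
  have hexp : Real.exp (-(W * ε ^ 2 / 4)) ≤ 1 / (n : ℝ) ^ 4 := by
    rw [← exp_neg_mul_log 4 hn]
    refine Real.exp_le_exp.mpr ?_
    push_cast
    nlinarith [mul_le_mul_of_nonneg_right hAW (sq_nonneg ε)]
  set Bad : Fin k → (Fin n → Fin k) → Prop := fun l σ =>
    if l = o then (cnt σ o : ℝ) < W * (1 - ε) else n * w l + W * ε < (cnt σ l : ℝ) with hBad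
  have hcover : ∀ σ : Fin n → Fin k, (∀ l, ¬ Bad l σ) → Leads o A δ (cnt σ) := by
    intro σ hσ
    have ho : W * (1 - ε) ≤ cnt σ o := by simpa [hBad] using hσ o
    refine ⟨le_trans ?_ ho, fun j hj => ?_⟩
    · have : A * (1 + D / 2) * (1 - ε) ≤ W * (1 - ε) :=
        mul_le_mul_of_nonneg_right hwo (by linarith)
      refine le_trans ?_ this
      have : 1 ≤ (1 + D / 2) * (1 - ε) := by nlinarith
      nlinarith
    · have h1 : (cnt σ j : ℝ) ≤ n * w j + W * ε := by simpa [hBad, hj] using hσ j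
      have h2 : (n : ℝ) * w j ≤ (1 - D) * W := by
        rw [hW]
        calc (n : ℝ) * w j ≤ n * ((1 - D) * w o) :=
              mul_le_mul_of_nonneg_left (hwj j hj) (Nat.cast_nonneg n)
          _ = _ := by ring
      have hW0 : 0 ≤ W := hA.trans hAW
      have h3 : (1 - δ) * (W * (1 - ε)) ≤ (1 - δ) * cnt σ o :=
        mul_le_mul_of_nonneg_left ho (by linarith)
      have h4 : W * (1 - D + ε) ≤ W * ((1 - δ) * (1 - ε)) := by
        refine mul_le_mul_of_nonneg_left ?_ hW0
        nlinarith [mul_le_mul_of_nonneg_right hδ hε0]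
      linarith
  have hbound : ∀ l, ∑ σ : Fin n → Fin k with Bad l σ, samplePr w σ ≤ 1 / (n : ℝ) ^ 4 := by
    intro l
    have : Nontrivial (Fin k) := Fin.nontrivial_iff_two_le.mpr hk
    obtain ⟨j, hj⟩ := exists_ne l
    refine le_trans ?_ hexp
    by_cases hl : l = o
    · subst hl
      simp only [hBad, if_true]
      exact sum_samplePr_lower_tail hw hw1 hj.symm hε0 (by linarith)
    · simp only [hBad, if_neg hl]
      refine sum_samplePr_upper_tail hw hw1 hj.symm ((hwj l hl).trans ?_) hε0 (by linarith)
      exact mul_le_of_le_one_left (hw o) (by linarith)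
  calc ∑ σ : Fin n → Fin k with ¬ Leads o A δ (cnt σ), samplePr w σ
      ≤ ∑ σ : Fin n → Fin k, ∑ l, if Bad l σ then samplePr w σ else 0 := by
        rw [Finset.sum_filter]
        refine Finset.sum_le_sum fun σ _ => ?_
        have hnn : ∀ l, 0 ≤ if Bad l σ then samplePr w σ else 0 := fun l => by
          split_ifs
          · exact samplePr_nonneg hw σ
          · exact le_rfl
        split_ifs with hσ
        · exact Finset.sum_nonneg fun l _ => hnn l
        · obtain ⟨l, hl⟩ : ∃ l, Bad l σ := by
            by_contra hcon
            push Not at hcon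
            exact hσ (hcover σ hcon)
          refine le_trans ?_ (Finset.single_le_sum (fun l _ => hnn l) (Finset.mem_univ l))
          rw [if_pos hl]
    _ = ∑ l, ∑ σ : Fin n → Fin k with Bad l σ, samplePr w σ := by
        rw [Finset.sum_comm]; simp only [Finset.sum_filter]
    _ ≤ ∑ _l : Fin k, 1 / (n : ℝ) ^ 4 := Finset.sum_le_sum fun l _ => hbound l
    _ = k * (1 / (n : ℝ) ^ 4) := by simp
    _ ≤ n * (1 / (n : ℝ) ^ 4) :=
        mul_le_mul_of_nonneg_right (by exact_mod_cast hkn) (by positivity)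
    _ = 1 / (n : ℝ) ^ 3 := by
        have : (n : ℝ) ≠ 0 := by exact_mod_cast hn.ne'
        field_simp

/-- The parameter range in which the analysis of a single round applies; `A` is a lower bound for
the number of supporters of the plurality opinion. -/
structure Regime (n k h : ℕ) (A : ℝ) : Prop where
  two_le : 2 ≤ k
  le : k ≤ n
  one_le : 1 ≤ h
  large : 1024 ≤ Real.log n
  half : A ≤ n / 2
  support : 2 ^ 16 * Real.log n ≤ A
  samples : 20480 * Real.log n ≤ h * (A / n)

lemma cast_div_sum_eq_one {n k : ℕ} (hn : 0 < n) {c : Fin k → ℕ} (hc : ∑ i, c i = n) :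
    ∑ i, (c i : ℝ) / n = 1 := by
  rw [← Finset.sum_div, ← Nat.cast_sum, hc, div_self (by exact_mod_cast hn.ne')]

lemma sum_cnt {k h : ℕ} (ω : Fin h → Fin k) : ∑ i, cnt ω i = h := by
  unfold cnt
  rw [← Finset.card_eq_sum_card_fiberwise fun _ _ => Finset.mem_coe.mpr (Finset.mem_univ _)]
  simp

namespace Regime

variable {n k h : ℕ} {A : ℝ}

lemma pos (H : Regime n k h A) : 0 < n := by
  have := H.two_le; have := H.le; omega

lemma support_pos (H : Regime n k h A) : 0 < A := by
  have := H.support; have := H.large; linarith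

lemma samples_le (H : Regime n k h A) {x : ℝ} (hx : A ≤ x) :
    20480 * Real.log n ≤ h * (x / n) :=
  H.samples.trans (by gcongr)

lemma exp_le (H : Regime n k h A) {x : ℝ} (hx : A ≤ x) :
    Real.exp (-(h * (x / n) / 4096)) ≤ 1 / (n : ℝ) ^ 5 := by
  rw [← exp_neg_mul_log 5 H.pos]
  refine Real.exp_le_exp.mpr ?_
  have := H.samples_le hx
  push_cast
  linarith

/-- A small lead doubles in one round, except with probability `n⁻³`. -/
lemma sum_not_leads_le (H : Regime n k h A) {o : Fin k} {c : Fin k → ℕ} (hc : ∑ i, c i = n)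
    {δ : ℝ} (hδ0 : 128 / Real.sqrt A ≤ δ) (hlead : Leads o A δ c)
    [DecidablePred fun σ : Fin n → Fin k => ¬ Leads o A (min (2 * δ) (1 / 32)) (cnt σ)] :
    ∑ σ : Fin n → Fin k with ¬ Leads o A (min (2 * δ) (1 / 32)) (cnt σ),
      samplePr (winPr k h fun i => (c i : ℝ) / n) σ ≤ 1 / (n : ℝ) ^ 3 := by
  have hn := H.pos
  have hA := H.support_pos
  have hn' : (0 : ℝ) < n := by exact_mod_cast hn
  have hlarge := H.large
  set p : Fin k → ℝ := fun i => (c i : ℝ) / n with hpdef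
  have hp : ∀ i, 0 ≤ p i := fun i => by positivity
  have hp1 : ∑ i, p i = 1 := cast_div_sum_eq_one hn hc
  have hpo : 0 < p o := div_pos (hA.trans_le hlead.1) hn'
  have hsA : 0 < Real.sqrt A := Real.sqrt_pos.mpr hA
  have hδpos : 0 ≤ δ := le_trans (by positivity) hδ0
  have hsl : 32 ≤ Real.sqrt (Real.log n) := Real.le_sqrt_of_sq_le (by linarith)
  set ℓ := ⌈Real.sqrt (Real.log n)⌉₊ with hℓdef
  have hℓle : Real.sqrt (Real.log n) ≤ ℓ := Nat.le_ceil _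
  have hℓlt : (ℓ : ℝ) < Real.sqrt (Real.log n) + 1 := Nat.ceil_lt_add_one (Real.sqrt_nonneg _)
  have hsq : Real.sqrt (Real.log n) ^ 2 = Real.log n := Real.sq_sqrt (by linarith)
  have hlam : 80 * (ℓ : ℝ) ^ 2 ≤ h * p o := by
    refine le_trans ?_ (H.samples_le hlead.1)
    nlinarith
  have hℓ : (32 : ℝ) ≤ ℓ := hsl.trans hℓle
  have hδ : ∀ j, j ≠ o → p j ≤ (1 - δ) * p o := fun j hj => by
    have := div_le_div_of_nonneg_right (hlead.2 j hj) hn'.le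
    rwa [mul_div_assoc] at this
  set D := min (2 * (ℓ : ℝ) * δ) 1 / 16 with hD
  have hD0 : 0 ≤ D := by positivity
  have hD1 : D ≤ 1 / 16 := by rw [hD]; linarith [min_le_right (2 * (ℓ : ℝ) * δ) 1]
  have hdrift : ∀ j, j ≠ o → winPr k h p j ≤ (1 - D) * (p j / p o) * winPr k h p o :=
    fun j hj => winPr_mul_le (n := n) (by have := H.two_le; have := H.le; omega) H.le H.one_le hp hp1
      hpo (fun i => by
        rcases Nat.eq_zero_or_pos (c i) with h0 | h0
        · left; simp [hpdef, h0]
        · right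
          exact div_le_div_of_nonneg_right (by exact_mod_cast h0) hn'.le)
      (by have : (16 : ℝ) ≤ ℓ := by linarith
          exact_mod_cast this) hlam (H.exp_le hlead.1) hδpos hδ hj
  have hw0 := winPr_nonneg (h := h) hp o
  have hgrow : A * (1 + D / 2) ≤ n * winPr k h p o := by
    have h1 := mul_le_winPr (h := h) hp1 (o := o) (α := A / n) (by positivity)
      (by rw [div_le_iff₀ hn']; linarith [H.half])
      (div_le_div_of_nonneg_right hlead.1 hn'.le) hD0 (by linarith) hdrift hw0
    calc A * (1 + D / 2) = n * (A / n * (1 + D / 2)) := by field_simp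
      _ ≤ _ := mul_le_mul_of_nonneg_left h1 hn'.le
  set ε := 4 * Real.sqrt (Real.log n) / Real.sqrt A with hε
  have hεle : ε ≤ 1 / 64 := by
    rw [hε, div_le_iff₀ hsA]
    have : 256 * Real.sqrt (Real.log n) ≤ Real.sqrt A := by
      refine Real.le_sqrt_of_sq_le ?_
      rw [mul_pow, hsq]
      linarith [H.support]
    linarith
  have hεδ : 32 * ε ≤ Real.sqrt (Real.log n) * δ := by
    calc 32 * ε = Real.sqrt (Real.log n) * (128 / Real.sqrt A) := by rw [hε]; ring
      _ ≤ _ := mul_le_mul_of_nonneg_left hδ0 (Real.sqrt_nonneg _)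
  refine sum_samplePr_not_leads_le H.two_le H.le (fun i => winPr_nonneg hp i)
    (sum_winPr o.pos hp1) hA.le (D := D) (ε := ε) (fun j hj => ?_) hgrow (by positivity) ?_ hD1 ?_ ?_
  · refine (hdrift j hj).trans ?_
    refine mul_le_mul_of_nonneg_right (mul_le_of_le_one_right (by linarith) ?_) hw0
    exact (div_le_one hpo).mpr ((hδ j hj).trans (mul_le_of_le_one_left hpo.le (by linarith)))
  · rw [hD, le_div_iff₀ (by norm_num)]
    refine le_min ?_ (by linarith)
    nlinarith [mul_le_mul_of_nonneg_right hℓle hδpos]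
  · rw [hε, div_pow, mul_pow, hsq, Real.sq_sqrt hA.le]
    exact le_of_eq (by field_simp; norm_num)
  · rw [hD, div_div, le_div_iff₀ (by norm_num)]
    refine le_min ?_ ?_
    · nlinarith [min_le_left (2 * δ) (1 / 32), mul_le_mul_of_nonneg_right hℓ hδpos]
    · linarith [min_le_right (2 * δ) (1 / 32)]

end Regime

lemma hitPr_eq_sum {n k h : ℕ} {o : Fin k} {t : ℕ} {c : Fin k → ℕ} (hc : c o ≠ n) :
    hitPr n k h o (t + 1) c = ∑ σ : Fin n → Fin k,
      samplePr (winPr k h fun i => (c i : ℝ) / n) σ * hitPr n k h o t (cnt σ) := by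
  rw [hitPr, if_neg hc]; rfl

lemma hitPr_nonneg {n k h : ℕ} {o : Fin k} (t : ℕ) (c : Fin k → ℕ) : 0 ≤ hitPr n k h o t c := by
  induction t generalizing c with
  | zero => rw [hitPr]; split_ifs <;> norm_num
  | succ t ih =>
    by_cases hc : c o = n
    · rw [hitPr, if_pos hc]; exact zero_le_one
    · rw [hitPr_eq_sum hc]
      refine Finset.sum_nonneg fun σ _ => mul_nonneg (samplePr_nonneg (fun i => ?_) σ) (ih _)
      exact winPr_nonneg (fun i => by positivity) i

namespace Regime

variable {n k h : ℕ} {A : ℝ}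

/-- A constant relative lead yields consensus in one round, except with probability `n⁻³`. -/
lemma le_hitPr_one (H : Regime n k h A) {o : Fin k} {c : Fin k → ℕ} (hc : ∑ i, c i = n)
    (hlead : Leads o A (1 / 32) c) : 1 - 1 / (n : ℝ) ^ 3 ≤ hitPr n k h o 1 c := by
  have hn := H.pos
  have hn' : (0 : ℝ) < n := by exact_mod_cast hn
  have hn1 : (1 : ℝ) ≤ n := by exact_mod_cast hn
  by_cases hco : c o = n
  · rw [hitPr, if_pos hco, sub_le_self_iff]; positivity
  rw [hitPr_eq_sum hco]
  set p : Fin k → ℝ := fun i => (c i : ℝ) / n with hpdef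
  have hp : ∀ i, 0 ≤ p i := fun i => by positivity
  have hp1 : ∑ i, p i = 1 := cast_div_sum_eq_one hn hc
  have hwj : ∀ j, j ≠ o → winPr k h p j ≤ 1 / (n : ℝ) ^ 5 := fun j hj => by
    refine le_trans ?_ (H.exp_le hlead.1)
    refine (winPr_le_exp hp hp1 hj.symm (y := 63 / 64) (by norm_num) (by norm_num) ?_).trans_eq
      (by congr 1; simp only [hpdef]; ring)
    have h1 := div_le_div_of_nonneg_right (hlead.2 j hj) hn'.le
    rw [mul_div_assoc] at h1
    exact h1.trans (mul_le_mul_of_nonneg_right (by norm_num) (hp o))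
  have hwo : 1 - 1 / (n : ℝ) ^ 4 ≤ winPr k h p o := by
    have h1 : 1 - winPr k h p o = ∑ j ∈ Finset.univ.erase o, winPr k h p j := by
      rw [← sum_winPr (h := h) o.pos hp1, ← Finset.add_sum_erase _ _ (Finset.mem_univ o)]; ring
    have h2 : ∑ j ∈ Finset.univ.erase o, winPr k h p j ≤ 1 / (n : ℝ) ^ 4 := by
      calc ∑ j ∈ Finset.univ.erase o, winPr k h p j
          ≤ ∑ j ∈ Finset.univ.erase o, 1 / (n : ℝ) ^ 5 :=
            Finset.sum_le_sum fun j hj => hwj j (Finset.ne_of_mem_erase hj)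
        _ ≤ ∑ j : Fin k, 1 / (n : ℝ) ^ 5 :=
            Finset.sum_le_sum_of_subset_of_nonneg (Finset.subset_univ _) fun _ _ _ => by positivity
        _ = k * (1 / (n : ℝ) ^ 5) := by simp
        _ ≤ n * (1 / (n : ℝ) ^ 5) :=
            mul_le_mul_of_nonneg_right (by exact_mod_cast H.le) (by positivity)
        _ = 1 / (n : ℝ) ^ 4 := by field_simp
    linarith
  have hpow : 1 / (n : ℝ) ^ 4 ≤ 1 := by
    rw [div_le_one (by positivity)]; exact one_le_pow₀ hn1
  calc 1 - 1 / (n : ℝ) ^ 3 = 1 + n * (-(1 / (n : ℝ) ^ 4)) := by field_simp; ring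
    _ ≤ (1 + -(1 / (n : ℝ) ^ 4)) ^ n := one_add_mul_le_pow (by linarith) n
    _ ≤ winPr k h p o ^ n := pow_le_pow_left₀ (by linarith) (by linarith) n
    _ = samplePr (winPr k h p) (fun _ : Fin n => o) * hitPr n k h o 0 (cnt fun _ : Fin n => o) := by
        simp [samplePr, hitPr, cnt]
    _ ≤ _ := Finset.single_le_sum (f := fun σ : Fin n → Fin k =>
        samplePr (winPr k h p) σ * hitPr n k h o 0 (cnt σ))
        (fun σ _ => mul_nonneg (samplePr_nonneg (fun i => winPr_nonneg hp i) σ) (hitPr_nonneg _ _))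
        (Finset.mem_univ _)

lemma le_hitPr (H : Regime n k h A) {o : Fin k} (t : ℕ) {c : Fin k → ℕ} (hc : ∑ i, c i = n)
    {δ : ℝ} (hδ0 : 128 / Real.sqrt A ≤ δ) (hδt : 1 / 32 ≤ 2 ^ t * δ)
    (hlead : Leads o A δ c) : 1 - (t + 1) * (1 / (n : ℝ) ^ 3) ≤ hitPr n k h o (t + 1) c := by
  classical
  induction t generalizing c δ with
  | zero =>
    have hlead' : Leads o A (1 / 32) c := ⟨hlead.1, fun j hj => (hlead.2 j hj).trans
      (mul_le_mul_of_nonneg_right (by linarith) (Nat.cast_nonneg _))⟩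
    simpa using H.le_hitPr_one hc hlead'
  | succ t ih =>
    have hn := H.pos
    have hη : 0 ≤ 1 / (n : ℝ) ^ 3 := by positivity
    by_cases hco : c o = n
    · rw [hitPr, if_pos hco, sub_le_self_iff]; positivity
    rw [hitPr_eq_sum hco]
    have hsA : 4096 ≤ Real.sqrt A := by
      refine Real.le_sqrt_of_sq_le ?_
      have := H.support; have := H.large; linarith
    have hδpos : 0 ≤ δ := le_trans (by positivity) hδ0
    have hδ0' : 128 / Real.sqrt A ≤ min (2 * δ) (1 / 32) := by
      refine le_min (by linarith) ?_
      rw [div_le_iff₀ (by linarith)]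
      linarith
    have hδt' : 1 / 32 ≤ 2 ^ t * min (2 * δ) (1 / 32) := by
      rw [mul_min_of_nonneg _ _ (by positivity)]
      refine le_min (by rw [pow_succ] at hδt; linarith) ?_
      have : (1 : ℝ) ≤ 2 ^ t := one_le_pow₀ (by norm_num)
      linarith
    have hbad := H.sum_not_leads_le hc hδ0 hlead
    set w := winPr k h fun i => (c i : ℝ) / n with hw
    have hw0 : ∀ i, 0 ≤ w i := fun i => winPr_nonneg (fun i => by positivity) i
    have htot : ∑ σ : Fin n → Fin k, samplePr w σ = 1 :=
      sum_samplePr n (sum_winPr o.pos (cast_div_sum_eq_one hn hc))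
    rw [← Finset.sum_filter_add_sum_filter_not _
      (fun σ : Fin n → Fin k => Leads o A (min (2 * δ) (1 / 32)) (cnt σ))] at htot
    set Good := ∑ σ : Fin n → Fin k with Leads o A (min (2 * δ) (1 / 32)) (cnt σ), samplePr w σ
    have hGood1 : Good ≤ 1 := by
      have : 0 ≤ ∑ σ : Fin n → Fin k with ¬ Leads o A (min (2 * δ) (1 / 32)) (cnt σ),
          samplePr w σ := Finset.sum_nonneg fun σ _ => samplePr_nonneg hw0 σ
      linarith
    calc 1 - ((t + 1 : ℕ) + 1) * (1 / (n : ℝ) ^ 3)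
        ≤ Good * (1 - (t + 1) * (1 / (n : ℝ) ^ 3)) := by
          push_cast
          have : 0 ≤ ((t : ℝ) + 1) * (1 / (n : ℝ) ^ 3) := by positivity
          nlinarith
      _ = ∑ σ : Fin n → Fin k with Leads o A (min (2 * δ) (1 / 32)) (cnt σ),
            samplePr w σ * (1 - (t + 1) * (1 / (n : ℝ) ^ 3)) := by rw [Finset.sum_mul]
      _ ≤ ∑ σ : Fin n → Fin k with Leads o A (min (2 * δ) (1 / 32)) (cnt σ),
            samplePr w σ * hitPr n k h o (t + 1) (cnt σ) := by
          refine Finset.sum_le_sum fun σ hσ => mul_le_mul_of_nonneg_left ?_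
            (samplePr_nonneg hw0 σ)
          exact ih (sum_cnt σ) hδ0' hδt' (Finset.mem_filter.mp hσ).2
      _ ≤ _ := Finset.sum_le_sum_of_subset_of_nonneg (Finset.subset_univ _) fun σ _ _ =>
          mul_nonneg (samplePr_nonneg hw0 σ) (hitPr_nonneg _ _)

end Regime

/-- the `h`-majority process started from a configuration with
plurality opinion 1 of density `p_1 = conf_0(1)/n ≥ C7·log n/n`, additive bias
`p_1 - p_j ≥ C8·√(p_1/n)` towards opinion 1, and `h·p_1 ≥ C4·log n`, reaches
consensus on opinion 1 within `C·log n` rounds with probability at least `1 - 1/n`. -/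
theorem h_majority_plurality_consensus :
    ∃ C4 C7 C8 C : ℝ, 0 < C4 ∧ 0 < C7 ∧ 0 < C8 ∧ 0 < C ∧
      ∃ n0 : ℕ, ∀ (n k h : ℕ), n0 ≤ n → ∀ (hk : 2 ≤ k), k ≤ n → 1 ≤ h →
        ∀ c0 : Fin k → ℕ, ∑ i, c0 i = n →
          C7 * Real.log n / n ≤ (c0 (o₁ k hk) : ℝ) / n →
          (∀ j : Fin k, j ≠ o₁ k hk →
            C8 * Real.sqrt (((c0 (o₁ k hk) : ℝ) / n) / n) ≤
              (c0 (o₁ k hk) : ℝ) / n - (c0 j : ℝ) / n) →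
          C4 * Real.log n ≤ (h : ℝ) * ((c0 (o₁ k hk) : ℝ) / n) →
          1 - 1 / (n : ℝ) ≤
            hitPr n k h (o₁ k hk) (Nat.floor (C * Real.log n)) c0 := by
  refine ⟨40960, 2 ^ 17, 256, 10, by norm_num, by norm_num, by norm_num, by norm_num,
    ⌈Real.exp 1024⌉₊, ?_⟩
  intro n k h hn0 hk hkn hh c0 hc hsupp hbias hsamp
  set x : ℝ := (c0 (o₁ k hk) : ℝ) with hx
  have hn : 0 < n := by omega
  have hn' : (0 : ℝ) < n := by exact_mod_cast hn
  have hlarge : 1024 ≤ Real.log n := by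
    rw [Real.le_log_iff_exp_le hn']
    exact (Nat.le_ceil _).trans (by exact_mod_cast hn0)
  have hlogn : Real.log n ≤ n - 1 := Real.log_le_sub_one_of_pos hn'
  have hsupp' : 2 ^ 17 * Real.log n ≤ x := (div_le_div_iff_of_pos_right hn').mp hsupp
  have hxn : x ≤ n := by
    rw [hx, ← hc]
    exact_mod_cast Finset.single_le_sum (fun i _ => Nat.zero_le (c0 i)) (Finset.mem_univ (o₁ k hk))
  have H : Regime n k h (x / 2) :=
    { two_le := hk
      le := hkn
      one_le := hh
      large := hlarge
      half := by linarith
      support := by linarith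
      samples := by
        have : (h : ℝ) * (x / 2 / n) = h * (x / n) / 2 := by ring
        rw [this]
        linarith }
  have hA := H.support_pos
  set s := Real.sqrt (x / 2) with hs
  have hs0 : 0 < s := Real.sqrt_pos.mpr hA
  have hs2 : s ^ 2 = x / 2 := Real.sq_sqrt hA.le
  have hlead : Leads (o₁ k hk) (x / 2) (128 / s) c0 := by
    refine ⟨by linarith, fun j hj => ?_⟩
    have h1 := hbias j hj
    rw [div_div, Real.sqrt_div (by linarith), Real.sqrt_mul_self hn'.le, ← sub_div,
      mul_div_assoc', div_le_div_iff_of_pos_right hn'] at h1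
    have h2 : s ≤ Real.sqrt x := Real.sqrt_le_sqrt (by linarith)
    have h3 : 128 / s * x = 256 * s := by
      rw [show x = 2 * s ^ 2 by linarith]; field_simp; norm_num
    change (c0 j : ℝ) ≤ (1 - 128 / s) * x
    linarith
  set t := Nat.floor (10 * Real.log n) - 1 with ht
  have hfl : Nat.floor (10 * Real.log n) = t + 1 := by
    have : 1 ≤ Nat.floor (10 * Real.log n) := Nat.le_floor (by push_cast; linarith)
    omega
  have htle : (t : ℝ) + 1 ≤ 10 * Real.log n := by
    have := Nat.floor_le (a := 10 * Real.log n) (by linarith)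
    rw [hfl] at this
    exact_mod_cast this
  have htge : 2 * Real.log n ≤ t := by
    have := Nat.lt_floor_add_one (10 * Real.log n)
    rw [hfl] at this
    push_cast at this
    linarith
  have hpow : (n : ℝ) ≤ 2 ^ t := by
    rw [← Real.log_le_log_iff hn' (by positivity), Real.log_pow]
    nlinarith [Real.log_two_gt_d9]
  have hδt : 1 / 32 ≤ 2 ^ t * (128 / s) := by
    have h1 : s ≤ x / 2 := by
      rw [← hs2]
      have : 1 ≤ s := Real.one_le_sqrt.mpr (by linarith)
      nlinarith
    rw [mul_div_assoc', le_div_iff₀ hs0]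
    linarith
  rw [hfl]
  refine le_trans (sub_le_sub_left ?_ 1) (H.le_hitPr t hc le_rfl hδt hlead)
  rw [mul_one_div, div_le_div_iff₀ (by positivity) hn']
  nlinarith [mul_le_mul_of_nonneg_right (show (t : ℝ) + 1 ≤ n ^ 2 by nlinarith) hn'.le]
end
end

section
/- There exist a constant C > 0 and a natural number n0 such that for all integers n ≥ n0 with k ≤ n the following holds: if p_1 ≥ p_2 ≥ … ≥ p_k and h·p_1 ≥ 324·log n, then Pr(W_1 | W_{1,2,strict}) − Pr(W_2 | W_{1,2,strict}) ≥ C · min( (p_1 − p_2)·√h / √(2·(p_1 + p_2)) , 1 ), where Pr(W_i | W_{1,2,strict}) denotes the conditional probability that opinion i wins the h-majority with uniform tie-breaking given that opinion 1 or 2 is the unique most sampled opinion. -/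
open scoped BigOperators

noncomputable section

/-- The probability that a binomial variable with weights `q`, `r` on success and failure and `m`
trials is at least `t`. -/
def binomTail (q r : ℝ) (m t : ℕ) : ℝ :=
  ∑ a ∈ Finset.Ico t (m + 1), (m.choose a : ℝ) * q ^ a * r ^ (m - a)

lemma binomTail_eq_add (q r : ℝ) {m t : ℕ} (h : t ≤ m) :
    binomTail q r m t = (m.choose t : ℝ) * q ^ t * r ^ (m - t) + binomTail q r m (t + 1) := by
  unfold binomTail
  rw [Finset.sum_eq_sum_Ico_succ_bot (by omega)]

lemma binomTail_succ_succ {q r : ℝ} (hqr : q + r = 1) {m t : ℕ} (h : t ≤ m) :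
    binomTail q r (m + 1) (t + 1) =
      binomTail q r m (t + 1) + q * ((m.choose t : ℝ) * q ^ t * r ^ (m - t)) := by
  have key : binomTail q r (m + 1) (t + 1) =
      q * binomTail q r m t + r * binomTail q r m (t + 1) := by
    have e : binomTail q r m (t + 1) =
        ∑ a ∈ Finset.Ico t (m + 1), (m.choose (a + 1) : ℝ) * q ^ (a + 1) * r ^ (m - (a + 1)) := by
      rw [Finset.sum_Ico_add' (fun a => (m.choose a : ℝ) * q ^ a * r ^ (m - a)),
        Finset.sum_Ico_succ_top (by omega)]
      simp [binomTail]
    rw [e]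
    unfold binomTail
    rw [← Finset.sum_Ico_add' _ t (m + 1) 1, Finset.mul_sum, Finset.mul_sum,
      ← Finset.sum_add_distrib]
    refine Finset.sum_congr rfl fun a ha => ?_
    rw [Finset.mem_Ico] at ha
    rw [Nat.choose_succ_succ, Nat.add_sub_add_right]
    rcases Nat.lt_or_ge a m with h' | h'
    · obtain ⟨d, rfl⟩ := Nat.exists_eq_add_of_lt h'
      rw [show a + d + 1 - a = d + 1 by omega, show a + d + 1 - (a + 1) = d by omega]
      push_cast
      ring
    · obtain rfl : a = m := by omega
      simp [pow_succ']
  rw [key, binomTail_eq_add q r h]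
  linear_combination (binomTail q r m (t + 1)) * hqr

lemma binomTail_le_one {q r : ℝ} (hq : 0 ≤ q) (hr : 0 ≤ r) (hqr : q + r = 1) (m t : ℕ) :
    binomTail q r m t ≤ 1 := by
  calc binomTail q r m t
      ≤ ∑ a ∈ Finset.range (m + 1), (m.choose a : ℝ) * q ^ a * r ^ (m - a) := by
        refine Finset.sum_le_sum_of_subset_of_nonneg ?_ fun _ _ _ => by positivity
        intro a ha
        simp only [Finset.mem_Ico, Finset.mem_range] at ha ⊢
        omega
    _ = (q + r) ^ m := by
        rw [add_pow]
        exact Finset.sum_congr rfl fun _ _ => by ring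
    _ = 1 := by rw [hqr, one_pow]

/-- The advantage of the likelier of two outcomes in a majority of an odd number of trials. -/
lemma binomTail_odd_sub {q r : ℝ} (hqr : q + r = 1) (l : ℕ) :
    binomTail q r (2 * l + 1) (l + 1) - binomTail r q (2 * l + 1) (l + 1) =
      (q - r) * ∑ i ∈ Finset.range (l + 1), (i.centralBinom : ℝ) * (q * r) ^ i := by
  induction l with
  | zero => simp [binomTail]
  | succ l ih =>
    have step : ∀ {q r : ℝ}, q + r = 1 → binomTail q r (2 * (l + 1) + 1) (l + 1 + 1) =
        binomTail q r (2 * l + 1) (l + 1) + ((l + 1).centralBinom : ℝ) * q * (q * r) ^ (l + 1)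
          - ((2 * l + 1).choose (l + 1) : ℝ) * (q * r) ^ (l + 1) := by
      intro q r hqr
      rw [show 2 * (l + 1) + 1 = (2 * l + 1 + 1) + 1 by ring,
        binomTail_succ_succ hqr (by omega), binomTail_succ_succ hqr (by omega),
        binomTail_eq_add q r (show l + 1 ≤ 2 * l + 1 by omega),
        show 2 * l + 1 - (l + 1) = l by omega, show 2 * l + 1 + 1 - (l + 1) = l + 1 by omega,
        Nat.centralBinom, show 2 * (l + 1) = 2 * l + 1 + 1 by ring]
      linear_combination
        ((2 * l + 1).choose (l + 1) : ℝ) * q ^ (l + 1) * r ^ l * hqr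
    rw [step hqr, step (by rw [add_comm, hqr]), Finset.sum_range_succ, mul_add, ← ih]
    ring

/-- Adding a trial to an odd number of trials does not change the advantage. -/
lemma binomTail_even_sub {q r : ℝ} (hqr : q + r = 1) (l : ℕ) :
    binomTail q r (2 * l + 2) (l + 2) - binomTail r q (2 * l + 2) (l + 2) =
      binomTail q r (2 * l + 1) (l + 1) - binomTail r q (2 * l + 1) (l + 1) := by
  have step : ∀ {q r : ℝ}, q + r = 1 → binomTail q r (2 * l + 2) (l + 2) =
      binomTail q r (2 * l + 1) (l + 1)
        - ((2 * l + 1).choose (l + 1) : ℝ) * (q * r) ^ (l + 1) := by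
    intro q r hqr
    rw [binomTail_succ_succ hqr (by omega),
      binomTail_eq_add q r (show l + 1 ≤ 2 * l + 1 by omega),
      show 2 * l + 1 - (l + 1) = l by omega]
    linear_combination
      ((2 * l + 1).choose (l + 1) : ℝ) * q ^ (l + 1) * r ^ l * hqr
  rw [step hqr, step (by rw [add_comm, hqr])]
  ring

lemma four_pow_sq_le_centralBinom (i : ℕ) :
    ((4 : ℝ) ^ i) ^ 2 ≤ (4 * i + 1) * (i.centralBinom : ℝ) ^ 2 := by
  induction i with
  | zero => simp
  | succ i ih =>
    have h : ((i : ℝ) + 1) * ((i + 1).centralBinom : ℝ) = 2 * (2 * i + 1) * i.centralBinom := by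
      exact_mod_cast Nat.succ_mul_centralBinom_succ i
    have hi : (0 : ℝ) < (i : ℝ) + 1 := by positivity
    refine le_of_mul_le_mul_left ?_ (pow_pos hi 2)
    calc ((i : ℝ) + 1) ^ 2 * ((4 : ℝ) ^ (i + 1)) ^ 2
        = 16 * ((i : ℝ) + 1) ^ 2 * ((4 : ℝ) ^ i) ^ 2 := by ring
      _ ≤ 16 * ((i : ℝ) + 1) ^ 2 * ((4 * i + 1) * (i.centralBinom : ℝ) ^ 2) := by gcongr
      _ = (16 * ((i : ℝ) + 1) ^ 2 * (4 * i + 1)) * (i.centralBinom : ℝ) ^ 2 := by ring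
      _ ≤ ((4 * (i + 1) + 1) * (2 * (2 * i + 1)) ^ 2) * (i.centralBinom : ℝ) ^ 2 := by
          refine mul_le_mul_of_nonneg_right ?_ (by positivity)
          nlinarith [Nat.cast_nonneg (α := ℝ) i]
      _ = (4 * (i + 1) + 1) * (2 * (2 * i + 1) * (i.centralBinom : ℝ)) ^ 2 := by ring
      _ = ((i : ℝ) + 1) ^ 2 * ((4 * ((i + 1 : ℕ) : ℝ) + 1) * ((i + 1).centralBinom : ℝ) ^ 2) := by
          rw [← h]
          push_cast
          ring

lemma centralBinom_partial_sum_lower {e : ℝ} (L : ℕ) (he : L * e ^ 2 ≤ 1 / 2) (he1 : e ^ 2 ≤ 1) :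
    Real.sqrt (L + 1) / 4 ≤
      ∑ i ∈ Finset.range (L + 1), (i.centralBinom : ℝ) * ((1 - e ^ 2) / 4) ^ i := by
  have hterm : ∀ i ∈ Finset.range (L + 1),
      1 / (4 * Real.sqrt (L + 1)) ≤ (i.centralBinom : ℝ) * ((1 - e ^ 2) / 4) ^ i := by
    intro i hi
    have hiL : (i : ℝ) ≤ L := by
      exact_mod_cast Nat.lt_succ_iff.mp (Finset.mem_range.mp hi)
    have hpow : 1 / 2 ≤ (1 - e ^ 2) ^ i := by
      have := one_add_mul_le_pow (show (-2 : ℝ) ≤ -e ^ 2 by linarith) i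
      rw [← sub_eq_add_neg] at this
      nlinarith [sq_nonneg e]
    have hc : (4 : ℝ) ^ i ≤ 2 * Real.sqrt (L + 1) * i.centralBinom := by
      refine le_of_sq_le_sq ?_ (by positivity)
      rw [mul_pow, mul_pow, Real.sq_sqrt (by positivity)]
      refine (four_pow_sq_le_centralBinom i).trans ?_
      gcongr
      linarith
    rw [div_pow, div_le_iff₀ (by positivity)]
    have h4 : (0 : ℝ) < 4 ^ i := by positivity
    rw [mul_assoc, div_mul_eq_mul_div, mul_div_assoc', le_div_iff₀ h4]
    nlinarith [mul_le_mul_of_nonneg_right hpow (le_trans h4.le hc)]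
  calc Real.sqrt (L + 1) / 4 = ∑ _i ∈ Finset.range (L + 1), 1 / (4 * Real.sqrt (L + 1)) := by
        have hs : Real.sqrt ((L : ℝ) + 1) ≠ 0 := by positivity
        rw [Finset.sum_const, Finset.card_range, nsmul_eq_mul]
        field_simp
        rw [Real.sq_sqrt (by positivity)]
        push_cast
        ring
    _ ≤ _ := Finset.sum_le_sum hterm

lemma centralBinom_sum_lower {e : ℝ} (he0 : 0 ≤ e) (he1 : e ≤ 1) (l : ℕ) :
    min (e * Real.sqrt (2 * l + 2)) 1 / 8 ≤
      e * ∑ i ∈ Finset.range (l + 1), (i.centralBinom : ℝ) * ((1 - e ^ 2) / 4) ^ i := by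
  have hsq : e ^ 2 ≤ 1 := by nlinarith
  have hbase : (0 : ℝ) ≤ (1 - e ^ 2) / 4 := by linarith
  have hs2 : Real.sqrt 2 ≤ 2 := by
    rw [Real.sqrt_le_left (by norm_num)]
    norm_num
  by_cases hl : l * e ^ 2 ≤ 1 / 2
  · have := mul_le_mul_of_nonneg_left (centralBinom_partial_sum_lower l hl hsq) he0
    refine le_trans ?_ this
    have h2 : Real.sqrt (2 * l + 2) ≤ 2 * Real.sqrt (l + 1) := by
      rw [show (2 * l + 2 : ℝ) = 2 * (l + 1) by ring, Real.sqrt_mul (by norm_num)]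
      gcongr
    have := min_le_left (e * Real.sqrt (2 * l + 2)) 1
    nlinarith [mul_le_mul_of_nonneg_left h2 he0]
  · push Not at hl
    have hepos : 0 < e := by
      rcases he0.eq_or_lt with rfl | h
      · norm_num at hl
      · exact h
    set L := ⌊1 / (2 * e ^ 2)⌋₊ with hL
    have hL1 : (L : ℝ) ≤ 1 / (2 * e ^ 2) := Nat.floor_le (by positivity)
    have hL2 : 1 / (2 * e ^ 2) < L + 1 := Nat.lt_floor_add_one _
    rw [le_div_iff₀ (by positivity)] at hL1
    rw [div_lt_iff₀ (by positivity)] at hL2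
    have hLl : L ≤ l := by
      have : (L : ℝ) * e ^ 2 ≤ l * e ^ 2 := by nlinarith
      exact_mod_cast le_of_mul_le_mul_right this (by positivity)
    have h1 := centralBinom_partial_sum_lower L (e := e) (by linarith) hsq
    have h2 : ∑ i ∈ Finset.range (L + 1), (i.centralBinom : ℝ) * ((1 - e ^ 2) / 4) ^ i ≤
        ∑ i ∈ Finset.range (l + 1), (i.centralBinom : ℝ) * ((1 - e ^ 2) / 4) ^ i :=
      Finset.sum_le_sum_of_subset_of_nonneg (Finset.range_mono (by omega))
        fun _ _ _ => by positivity
    have h3 : 1 / 2 ≤ e * Real.sqrt (L + 1) := by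
      refine le_of_sq_le_sq ?_ (by positivity)
      rw [mul_pow, Real.sq_sqrt (by positivity)]
      nlinarith
    have := mul_le_mul_of_nonneg_left (h1.trans h2) he0
    have := min_le_right (e * Real.sqrt (2 * l + 2)) 1
    linarith

/-- Bias of a strict majority of `m` trials. -/
lemma binomTail_majority_sub_lower {q r : ℝ} (hr : 0 ≤ r) (hrq : r ≤ q) (hqr : q + r = 1) (m : ℕ) :
    min ((q - r) * Real.sqrt m) 1 / 8 ≤
      binomTail q r m (m / 2 + 1) - binomTail r q m (m / 2 + 1) := by
  have hprod : q * r = (1 - (q - r) ^ 2) / 4 := by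
    obtain rfl : q = 1 - r := by linarith
    ring
  have hodd : ∀ l : ℕ, min ((q - r) * Real.sqrt (2 * l + 2)) 1 / 8 ≤
      binomTail q r (2 * l + 1) (l + 1) - binomTail r q (2 * l + 1) (l + 1) := by
    intro l
    rw [binomTail_odd_sub hqr, hprod]
    exact centralBinom_sum_lower (by linarith) (by linarith) l
  have hqr0 : 0 ≤ q - r := by linarith
  rcases Nat.even_or_odd' m with ⟨l, rfl | rfl⟩
  · rcases l with _ | l
    · simp [binomTail]
    · rw [show 2 * (l + 1) / 2 + 1 = l + 2 by omega, show 2 * (l + 1) = 2 * l + 2 by ring,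
        binomTail_even_sub hqr]
      simpa using hodd l
  · rw [show (2 * l + 1) / 2 + 1 = l + 1 by omega]
    refine le_trans ?_ (hodd l)
    gcongr
    push_cast
    linarith

/-- Nonnegativity of the advantage survives restricting to outcomes with larger leads. -/
lemma sum_filter_majority_nonneg {q r δ : ℝ} (hr : 0 ≤ r) (hrq : r ≤ q) (hδ0 : 0 ≤ δ) (hδ1 : δ ≤ 1)
    (m : ℕ) (Q : ℕ → Prop) [DecidablePred Q] (hQ : ∀ a b, a ≤ b → Q a → Q b)
    (hfull : 0 ≤ ∑ a ∈ Finset.Ico (m / 2 + 1) (m + 1),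
      (m.choose a : ℝ) * ((1 - δ) * (q ^ a * r ^ (m - a)) - (1 + δ) * (r ^ a * q ^ (m - a)))) :
    0 ≤ ∑ a ∈ (Finset.Ico (m / 2 + 1) (m + 1)).filter Q,
      (m.choose a : ℝ) * ((1 - δ) * (q ^ a * r ^ (m - a)) - (1 + δ) * (r ^ a * q ^ (m - a))) := by
  have hq : 0 ≤ q := hr.trans hrq
  set ψ : ℕ → ℝ := fun a => (1 - δ) * (q ^ a * r ^ (m - a)) - (1 + δ) * (r ^ a * q ^ (m - a))
    with hψ
  have hmono : ∀ a b, a ≤ b → b ≤ m → 0 ≤ ψ a → 0 ≤ ψ b := by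
    intro a b hab hbm ha
    obtain ⟨d, rfl⟩ := Nat.exists_eq_add_of_le hab
    obtain ⟨c, rfl⟩ := Nat.exists_eq_add_of_le hbm
    simp only [hψ, show a + d + c - (a + d) = c by omega,
      show a + d + c - a = d + c by omega] at ha ⊢
    have hd : r ^ d ≤ q ^ d := pow_le_pow_left₀ hr hrq d
    have hd' : 0 ≤ q ^ d - r ^ d := by linarith
    have hδ' : 0 ≤ 1 - δ := by linarith
    have h1 : 0 ≤ (1 - δ) * (q ^ a * r ^ c) * (q ^ d - r ^ d) := by positivity
    have h2 : 0 ≤ (1 + δ) * (r ^ a * q ^ c) * (q ^ d - r ^ d) := by positivity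
    rw [pow_add] at ha
    rw [pow_add, pow_add]
    rw [pow_add q] at ha
    linarith
  by_cases hex : ∃ a ∈ Finset.Ico (m / 2 + 1) (m + 1), ¬ Q a ∧ 0 ≤ ψ a
  · obtain ⟨a, -, hQa, hψa⟩ := hex
    refine Finset.sum_nonneg fun b hb => ?_
    simp only [Finset.mem_filter, Finset.mem_Ico] at hb
    have hab : a ≤ b := by
      by_contra! h
      exact hQa (hQ b a h.le hb.2)
    exact mul_nonneg (by positivity) (hmono a b hab (by omega) hψa)
  · push Not at hex
    rw [← Finset.sum_filter_add_sum_filter_not _ Q] at hfull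
    have : ∑ a ∈ (Finset.Ico (m / 2 + 1) (m + 1)).filter (fun a => ¬ Q a),
        (m.choose a : ℝ) * ψ a ≤ 0 := by
      refine Finset.sum_nonpos fun a ha => ?_
      rw [Finset.mem_filter] at ha
      exact mul_nonpos_of_nonneg_of_nonpos (by positivity) (hex a ha.1 ha.2).le
    linarith

lemma sum_filter_majority_nonneg_of_probability {q r : ℝ} (hr : 0 ≤ r) (hrq : r ≤ q)
    (hqr : q + r = 1) (m : ℕ) (Q : ℕ → Prop) [DecidablePred Q] (hQ : ∀ a b, a ≤ b → Q a → Q b)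
    {δ : ℝ} (hδ0 : 0 ≤ δ) (hδ : δ ≤ min ((q - r) * Real.sqrt m) 1 / 16) :
    0 ≤ ∑ a ∈ (Finset.Ico (m / 2 + 1) (m + 1)).filter Q,
      (m.choose a : ℝ) * ((1 - δ) * (q ^ a * r ^ (m - a)) - (1 + δ) * (r ^ a * q ^ (m - a))) := by
  have hq : 0 ≤ q := hr.trans hrq
  have hδ1 : δ ≤ 1 := by linarith [min_le_right ((q - r) * Real.sqrt m) 1]
  refine sum_filter_majority_nonneg hr hrq hδ0 hδ1 m Q hQ ?_
  have e : ∑ a ∈ Finset.Ico (m / 2 + 1) (m + 1),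
      (m.choose a : ℝ) * ((1 - δ) * (q ^ a * r ^ (m - a)) - (1 + δ) * (r ^ a * q ^ (m - a))) =
      (1 - δ) * binomTail q r m (m / 2 + 1) - (1 + δ) * binomTail r q m (m / 2 + 1) := by
    unfold binomTail
    rw [Finset.mul_sum, Finset.mul_sum, ← Finset.sum_sub_distrib]
    exact Finset.sum_congr rfl fun _ _ => by ring
  rw [e]
  have h1 := binomTail_majority_sub_lower hr hrq hqr m
  have h2 := binomTail_le_one hq hr hqr m (m / 2 + 1)
  have h3 := binomTail_le_one hr hq (by linarith) m (m / 2 + 1)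
  nlinarith

lemma sum_filter_majority_nonneg_of_weights {u v : ℝ} (hv : 0 ≤ v) (hvu : v ≤ u) (hs : 0 < u + v)
    (m : ℕ) (Q : ℕ → Prop) [DecidablePred Q] (hQ : ∀ a b, a ≤ b → Q a → Q b)
    {δ : ℝ} (hδ0 : 0 ≤ δ) (hδ : δ ≤ min ((u - v) / (u + v) * Real.sqrt m) 1 / 16) :
    0 ≤ ∑ a ∈ (Finset.Ico (m / 2 + 1) (m + 1)).filter Q,
      (m.choose a : ℝ) * ((1 - δ) * (u ^ a * v ^ (m - a)) - (1 + δ) * (v ^ a * u ^ (m - a))) := by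
  rw [sub_div] at hδ
  have h := sum_filter_majority_nonneg_of_probability (div_nonneg hv hs.le)
    (div_le_div_of_nonneg_right hvu hs.le) (by field_simp) m Q hQ hδ0 hδ
  have h' := mul_nonneg (pow_nonneg hs.le m) h
  rw [Finset.mul_sum] at h'
  refine h'.trans_eq (Finset.sum_congr rfl fun a ha => ?_)
  simp only [Finset.mem_filter, Finset.mem_Ico] at ha
  obtain ⟨b, rfl⟩ := Nat.exists_eq_add_of_le (show a ≤ m by omega)
  rw [show a + b - a = b by omega]
  have hs' : u + v ≠ 0 := hs.ne'
  simp only [div_pow]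
  field_simp
  ring

lemma multiPr_nonneg {k h : ℕ} {p : Fin k → ℝ} (hp : ∀ i, 0 ≤ p i) (A : Set (Fin h → Fin k)) :
    0 ≤ multiPr k h p A :=
  Finset.sum_nonneg fun _ _ => Set.indicator_nonneg (fun _ _ => Finset.prod_nonneg fun _ _ => hp _) _

lemma sum_weight_eq_prod {k h : ℕ} (f : Fin k → ℝ) :
    ∑ ω : Fin h → Fin k, ∏ l, f (ω l) = (∑ i, f i) ^ h := by
  rw [← Fintype.piFinset_univ, Finset.sum_prod_piFinset Finset.univ fun _ => f]
  simp

lemma multiPr_univ {k h : ℕ} {p : Fin k → ℝ} (hsum : ∑ i, p i = 1) :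
    multiPr k h p Set.univ = 1 := by
  simp only [multiPr, Set.indicator_univ]
  rw [sum_weight_eq_prod, hsum, one_pow]

lemma disjoint_Wstrict {k h : ℕ} {i j : Fin k} (hij : i ≠ j) :
    Disjoint (Wstrict k h i) (Wstrict k h j) :=
  Set.disjoint_left.mpr fun _ hi hj => lt_asymm (hi j hij.symm) (hj i hij)

lemma multiPr_W12strict {k h : ℕ} (p : Fin k → ℝ) {i j : Fin k} (hij : i ≠ j) :
    multiPr k h p (W12strict k h i j) =
      multiPr k h p (Wstrict k h i) + multiPr k h p (Wstrict k h j) := by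
  simp only [multiPr, W12strict]
  rw [Set.indicator_union_of_disjoint (disjoint_Wstrict hij), Finset.sum_add_distrib]

lemma maxCnt_eq_of_mem_Wties {k h : ℕ} {i : Fin k} {ω : Fin h → Fin k} (hω : ω ∈ Wties k h i) :
    maxCnt ω = cnt ω i := by
  refine le_antisymm (Finset.sup_le fun j _ => ?_) (Finset.le_sup (Finset.mem_univ i))
  rcases eq_or_ne j i with rfl | h
  · exact le_rfl
  · exact hω j h

lemma Wstrict_subset_Wties {k h : ℕ} (i : Fin k) : Wstrict k h i ⊆ Wties k h i :=
  fun _ hω j hj => (hω j hj).le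

lemma numMax_eq_one_of_mem_Wstrict {k h : ℕ} {i : Fin k} {ω : Fin h → Fin k}
    (hω : ω ∈ Wstrict k h i) : numMax ω = 1 := by
  rw [numMax, Finset.card_eq_one]
  refine ⟨i, Finset.ext fun j => ?_⟩
  rw [maxCnt_eq_of_mem_Wties (Wstrict_subset_Wties i hω)]
  simp only [Finset.mem_filter, Finset.mem_univ, true_and, Finset.mem_singleton]
  refine ⟨fun h => ?_, fun h => by rw [h]⟩
  by_contra hne
  exact (hω j hne).ne h

lemma winPrOn_W12strict {k h : ℕ} (p : Fin k → ℝ) (i j : Fin k) :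
    winPrOn k h p (W12strict k h i j) i = multiPr k h p (Wstrict k h i) := by
  have hset : W12strict k h i j ∩ {ω | cnt ω i = maxCnt ω} = Wstrict k h i := by
    ext ω
    constructor
    · rintro ⟨hi | hj, hmax⟩
      · exact hi
      · by_cases hij : i = j
        · exact hij ▸ hj
        · rw [Set.mem_ofPred_eq, maxCnt_eq_of_mem_Wties (Wstrict_subset_Wties j hj)] at hmax
          exact absurd hmax (hj i hij).ne
    · intro hω
      exact ⟨Or.inl hω, (maxCnt_eq_of_mem_Wties (Wstrict_subset_Wties i hω)).symm⟩
  unfold winPrOn multiPr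
  rw [hset]
  refine Finset.sum_congr rfl fun ω _ => ?_
  by_cases hω : ω ∈ Wstrict k h i
  · rw [Set.indicator_of_mem hω, Set.indicator_of_mem hω, numMax_eq_one_of_mem_Wstrict hω]
    simp
  · rw [Set.indicator_of_notMem hω, Set.indicator_of_notMem hω]

lemma W12strict_comm (k h : ℕ) (i j : Fin k) : W12strict k h i j = W12strict k h j i :=
  Set.union_comm _ _

lemma prod_weight_eq {k h : ℕ} (p : Fin k → ℝ) {i j : Fin k} (hij : i ≠ j) (ω : Fin h → Fin k) :
    ∏ l, p (ω l) = p i ^ cnt ω i * p j ^ cnt ω j *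
      ∏ l with ω l ≠ i ∧ ω l ≠ j, p (ω l) := by
  have hpow : ∀ x, ∏ l with ω l = x, p (ω l) = p x ^ cnt ω x := by
    intro x
    rw [Finset.prod_congr rfl (g := fun _ => p x), Finset.prod_const, cnt]
    intro l hl
    rw [(Finset.mem_filter.mp hl).2]
  rw [← Finset.prod_filter_mul_prod_filter_not Finset.univ (fun l => ω l = i), hpow, mul_assoc,
    ← Finset.prod_filter_mul_prod_filter_not (Finset.univ.filter fun l => ¬ ω l = i)
      (fun l => ω l = j), Finset.filter_filter, Finset.filter_filter, ← hpow j]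
  congr 3
  ext l
  simp only [Finset.mem_filter, Finset.mem_univ, true_and, and_iff_right_iff_imp]
  rintro h rfl
  exact hij h

/-- Identify opinion `j` with opinion `i` in a sample. -/
def mergeOpinion {k h : ℕ} (i j : Fin k) (ω : Fin h → Fin k) : Fin h → Fin k :=
  fun l => if ω l = j then i else ω l

lemma cnt_mergeOpinion_left {k h : ℕ} {i j : Fin k} (hij : i ≠ j) (ω : Fin h → Fin k) :
    cnt (mergeOpinion i j ω) i = cnt ω i + cnt ω j := by
  unfold cnt mergeOpinion
  rw [← Finset.card_union_of_disjoint]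
  · congr 1
    ext l
    simp only [Finset.mem_filter, Finset.mem_univ, true_and, Finset.mem_union]
    split_ifs with h <;> simp [h]
  · rw [Finset.disjoint_filter]
    rintro l - h1 h2
    exact hij (h1 ▸ h2)

lemma cnt_mergeOpinion_of_ne {k h : ℕ} {i j x : Fin k} (hxi : x ≠ i) (hxj : x ≠ j)
    (ω : Fin h → Fin k) : cnt (mergeOpinion i j ω) x = cnt ω x := by
  unfold cnt mergeOpinion
  congr 1
  ext l
  simp only [Finset.mem_filter, Finset.mem_univ, true_and]
  split_ifs with h
  · simp [h, hxi.symm, hxj.symm]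
  · rfl

/-- The contribution of a sample to the advantage of `i` over `j` beyond the fraction `δ`. -/
def excess {k h : ℕ} (p : Fin k → ℝ) (i j : Fin k) (δ : ℝ) (ω : Fin h → Fin k) : ℝ :=
  (1 - δ) * (Wstrict k h i).indicator (fun ω => ∏ l, p (ω l)) ω -
    (1 + δ) * (Wstrict k h j).indicator (fun ω => ∏ l, p (ω l)) ω

/-- A sum over the samples with prescribed merged sample, through the positions of opinion `i`. -/
lemma sum_mergeOpinion_fiber {k h : ℕ} {i j : Fin k} (hij : i ≠ j) {τ : Fin h → Fin k}
    (hτ : ∀ l, τ l ≠ j) (F : (Fin h → Fin k) → ℝ) (H : ℕ → ℝ)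
    (hF : ∀ ω, mergeOpinion i j ω = τ → F ω = H (cnt ω i)) :
    ∑ ω with mergeOpinion i j ω = τ, F ω =
      ∑ a ∈ Finset.range (cnt τ i + 1), ((cnt τ i).choose a : ℝ) * H a := by
  have h1 := Finset.sum_powerset_apply_card H (x := Finset.univ.filter fun l => τ l = i)
  simp only [nsmul_eq_mul] at h1
  unfold cnt at hF ⊢
  rw [← h1]
  refine Finset.sum_bij' (fun ω _ => Finset.univ.filter fun l => ω l = i)
    (fun A _ l => if τ l = i then (if l ∈ A then i else j) else τ l) ?_ ?_ ?_ ?_ ?_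
  · intro ω hω
    simp only [Finset.mem_filter, Finset.mem_univ, true_and] at hω
    subst hω
    rw [Finset.mem_powerset]
    intro l hl
    simp only [Finset.mem_filter, Finset.mem_univ, true_and, mergeOpinion] at hl ⊢
    simp [hl]
  · intro A hA
    rw [Finset.mem_powerset] at hA
    simp only [Finset.mem_filter, Finset.mem_univ, true_and]
    funext l
    unfold mergeOpinion
    by_cases h : τ l = i
    · by_cases hl : l ∈ A <;> simp [h, hl]
    · simp [h, hτ l]
  · intro ω hω
    simp only [Finset.mem_filter, Finset.mem_univ, true_and] at hω
    subst hω
    funext l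
    unfold mergeOpinion
    by_cases h1 : ω l = j
    · simp [h1, hij.symm]
    · by_cases h2 : ω l = i <;> simp [h1, h2]
  · intro A hA
    rw [Finset.mem_powerset] at hA
    ext l
    simp only [Finset.mem_filter, Finset.mem_univ, true_and]
    by_cases h : τ l = i
    · by_cases hl : l ∈ A <;> simp [h, hl, hij.symm]
    · simp only [h, if_false, false_iff]
      exact fun hl => h (Finset.mem_filter.mp (hA hl)).2
  · intro ω hω
    exact hF ω (Finset.mem_filter.mp hω).2

lemma sum_range_choose_eq (u v δ : ℝ) (m : ℕ) (Q : ℕ → Prop) [DecidablePred Q] :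
    ∑ a ∈ Finset.range (m + 1), (m.choose a : ℝ) *
      ((1 - δ) * (if Q a ∧ m - a < a then u ^ a * v ^ (m - a) else 0) -
        (1 + δ) * (if Q (m - a) ∧ a < m - a then u ^ a * v ^ (m - a) else 0)) =
    ∑ a ∈ (Finset.Ico (m / 2 + 1) (m + 1)).filter Q,
      (m.choose a : ℝ) * ((1 - δ) * (u ^ a * v ^ (m - a)) - (1 + δ) * (v ^ a * u ^ (m - a))) := by
  have hflip : ∑ a ∈ Finset.range (m + 1), (m.choose a : ℝ) *
        ((1 + δ) * (if Q (m - a) ∧ a < m - a then u ^ a * v ^ (m - a) else 0)) =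
      ∑ a ∈ Finset.range (m + 1), (m.choose a : ℝ) *
        ((1 + δ) * (if Q a ∧ m - a < a then v ^ a * u ^ (m - a) else 0)) := by
    rw [← Finset.sum_flip]
    refine Finset.sum_congr rfl fun a ha => ?_
    have ha' : a ≤ m := Nat.lt_succ_iff.mp (Finset.mem_range.mp ha)
    rw [Nat.choose_symm ha', Nat.sub_sub_self ha', mul_comm (u ^ (m - a))]
  simp only [mul_sub, Finset.sum_sub_distrib]
  rw [hflip, ← Finset.sum_sub_distrib, ← Finset.sum_sub_distrib]
  have hset : (Finset.Ico (m / 2 + 1) (m + 1)).filter Q =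
      (Finset.range (m + 1)).filter fun a => Q a ∧ m - a < a := by
    ext a
    simp only [Finset.mem_filter, Finset.mem_Ico, Finset.mem_range]
    constructor
    · rintro ⟨⟨h1, h2⟩, h3⟩
      exact ⟨h2, h3, by omega⟩
    · rintro ⟨h1, h2, h3⟩
      exact ⟨⟨by omega, h1⟩, h2⟩
  rw [hset, Finset.sum_filter]
  refine Finset.sum_congr rfl fun a _ => ?_
  split_ifs <;> simp

lemma sum_excess_fiber_nonneg {k h : ℕ} {p : Fin k → ℝ} (hp : ∀ i, 0 ≤ p i) {i j : Fin k}
    (hij : i ≠ j) (hji : p j ≤ p i) (hs : 0 < p i + p j) (τ : Fin h → Fin k) {δ : ℝ} (hδ0 : 0 ≤ δ)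
    (hδ : δ ≤ min ((p i - p j) / (p i + p j) * Real.sqrt (cnt τ i)) 1 / 16) :
    0 ≤ ∑ ω with mergeOpinion i j ω = τ, excess p i j δ ω := by
  classical
  by_cases hτ : ∀ l, τ l ≠ j
  swap
  · push Not at hτ
    obtain ⟨l, hl⟩ := hτ
    rw [Finset.filter_eq_empty_iff.mpr, Finset.sum_empty]
    rintro ω - rfl
    unfold mergeOpinion at hl
    split_ifs at hl with h
    · exact hij hl
    · exact h hl
  let Q : ℕ → Prop := fun a => ∀ x, x ≠ i → x ≠ j → cnt τ x < a
  set m := cnt τ i with hm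
  set R : ℝ := ∏ l with τ l ≠ i, p (τ l) with hR
  have hR0 : 0 ≤ R := Finset.prod_nonneg fun _ _ => hp _
  rw [sum_mergeOpinion_fiber hij hτ (excess p i j δ) (fun a => R *
      ((1 - δ) * (if Q a ∧ m - a < a then p i ^ a * p j ^ (m - a) else 0) -
        (1 + δ) * (if Q (m - a) ∧ a < m - a then p i ^ a * p j ^ (m - a) else 0)))]
  · simp only [← hm, mul_left_comm _ R]
    rw [← Finset.mul_sum, sum_range_choose_eq]
    refine mul_nonneg hR0 (sum_filter_majority_nonneg_of_weights (hp j) hji hs m Q ?_ hδ0 hδ)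
    exact fun a b hab h x hxi hxj => (h x hxi hxj).trans_le hab
  · rintro ω hω
    have hma : m - cnt ω i = cnt ω j := by
      rw [hm, ← hω, cnt_mergeOpinion_left hij]
      omega
    have hcnt : ∀ x, x ≠ i → x ≠ j → cnt τ x = cnt ω x := by
      intro x hxi hxj
      rw [← hω, cnt_mergeOpinion_of_ne hxi hxj]
    have hRω : ∏ l with ω l ≠ i ∧ ω l ≠ j, p (ω l) = R := by
      rw [hR, ← hω]
      refine Finset.prod_congr (Finset.filter_congr fun l _ => ?_) fun l hl => ?_
      · unfold mergeOpinion
        split_ifs with h <;> simp [h]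
      · rw [mergeOpinion, if_neg fun h => (Finset.mem_filter.mp hl).2 (by simp [mergeOpinion, h])]
    have hWi : ω ∈ Wstrict k h i ↔ Q (cnt ω i) ∧ cnt ω j < cnt ω i := by
      constructor
      · exact fun hW => ⟨fun x hxi hxj => hcnt x hxi hxj ▸ hW x hxi, hW j hij.symm⟩
      · rintro ⟨h1, h2⟩ x hxi
        by_cases hxj : x = j
        · exact hxj ▸ h2
        · exact hcnt x hxi hxj ▸ h1 x hxi hxj
    have hWj : ω ∈ Wstrict k h j ↔ Q (cnt ω j) ∧ cnt ω i < cnt ω j := by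
      constructor
      · exact fun hW => ⟨fun x hxi hxj => hcnt x hxi hxj ▸ hW x hxj, hW i hij⟩
      · rintro ⟨h1, h2⟩ x hxj
        by_cases hxi : x = i
        · exact hxi ▸ h2
        · exact hcnt x hxi hxj ▸ h1 x hxi hxj
    simp only [excess, Set.indicator_apply, hma, prod_weight_eq p hij ω, hRω, hWi, hWj]
    split_ifs <;> ring

/-- The advantage of `i` over `j`, up to the event that they are sampled less than `m₀` times. -/
lemma multiPr_Wstrict_sub_lower {k h : ℕ} {p : Fin k → ℝ} (hp : ∀ i, 0 ≤ p i) {i j : Fin k}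
    (hij : i ≠ j) (hji : p j ≤ p i) (hs : 0 < p i + p j) (m₀ : ℝ) {δ : ℝ} (hδ0 : 0 ≤ δ)
    (hδ : δ ≤ min ((p i - p j) / (p i + p j) * Real.sqrt m₀) 1 / 16) :
    δ * (multiPr k h p (W12strict k h i j) -
        multiPr k h p {ω | ((cnt ω i + cnt ω j : ℕ) : ℝ) < m₀}) ≤
      multiPr k h p (Wstrict k h i) - multiPr k h p (Wstrict k h j) := by
  classical
  set δ' : (Fin h → Fin k) → ℝ := fun τ => if (cnt τ i : ℝ) < m₀ then 0 else δ with hδ'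
  have hsum : 0 ≤ ∑ ω : Fin h → Fin k, excess p i j (δ' (mergeOpinion i j ω)) ω := by
    rw [← Finset.sum_fiberwise Finset.univ (mergeOpinion i j)]
    refine Finset.sum_nonneg fun τ _ => ?_
    rw [Finset.sum_congr rfl (g := excess p i j (δ' τ))]
    · have hnn : 0 ≤ (p i - p j) / (p i + p j) := div_nonneg (by linarith) hs.le
      refine sum_excess_fiber_nonneg hp hij hji hs τ ?_ ?_
      · simp only [hδ']
        split_ifs <;> simp [hδ0]
      · simp only [hδ']
        split_ifs with hlow
        · positivity
        · refine hδ.trans ?_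
          push Not at hlow
          gcongr
    · intro ω hω
      rw [(Finset.mem_filter.mp hω).2]
  rw [← sub_nonneg]
  refine hsum.trans ?_
  rw [multiPr_W12strict p hij]
  unfold multiPr
  rw [← Finset.sum_add_distrib, ← Finset.sum_sub_distrib, ← Finset.sum_sub_distrib, Finset.mul_sum,
    ← Finset.sum_sub_distrib]
  refine Finset.sum_le_sum fun ω _ => ?_
  have hw : 0 ≤ ∏ l, p (ω l) := Finset.prod_nonneg fun _ _ => hp _
  have hdis : ω ∈ Wstrict k h i → ω ∉ Wstrict k h j :=
    fun h1 => Set.disjoint_left.mp (disjoint_Wstrict hij) h1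
  simp only [excess, hδ', cnt_mergeOpinion_left hij, Set.indicator_apply, Set.mem_ofPred_eq]
  by_cases h1 : ω ∈ Wstrict k h i
  · simp only [h1, hdis h1, if_true, if_false]
    split_ifs <;> nlinarith [mul_nonneg hδ0 hw]
  · simp only [h1, if_false]
    split_ifs <;> nlinarith [mul_nonneg hδ0 hw]

/-- A Chernoff bound for the joint number of samples of two opinions. -/
lemma multiPr_cnt_add_cnt_lt_le {k h : ℕ} {p : Fin k → ℝ} (hp : ∀ i, 0 ≤ p i)
    (hsum : ∑ i, p i = 1) {i j : Fin k} (hij : i ≠ j) (m₀ : ℝ) :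
    multiPr k h p {ω | ((cnt ω i + cnt ω j : ℕ) : ℝ) < m₀} ≤
      Real.exp (m₀ - h * (p i + p j) / 2) := by
  classical
  set e := Real.exp (-1) with he
  have he0 : 0 < e := Real.exp_pos _
  have he1 : e ≤ 1 / 2 := by
    rw [he, Real.exp_neg, one_div]
    gcongr
    linarith [Real.add_one_le_exp (1 : ℝ)]
  set y : Fin k → ℝ := fun x => (if x = i then e else 1) * (if x = j then e else 1) with hy
  have hyprod : ∀ ω : Fin h → Fin k, ∏ l, y (ω l) = e ^ (cnt ω i + cnt ω j) := by
    intro ω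
    simp only [hy, Finset.prod_mul_distrib, Finset.prod_ite, Finset.prod_const, one_pow, mul_one,
      cnt, pow_add]
  have hpy : ∑ x, p x * y x ≤ Real.exp (-((p i + p j) / 2)) := by
    have hterm : ∀ x, p x * y x ≤
        p x - (if x = i then p i / 2 else 0) - (if x = j then p j / 2 else 0) := by
      intro x
      simp only [hy]
      by_cases h1 : x = i
      · subst h1
        simp only [if_true, hij, if_false]
        nlinarith [hp x]
      · by_cases h2 : x = j
        · subst h2
          simp only [if_true, h1, if_false]
          nlinarith [hp x]
        · simp [h1, h2]
    refine (Finset.sum_le_sum fun x _ => hterm x).trans ?_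
    rw [Finset.sum_sub_distrib, Finset.sum_sub_distrib, hsum]
    simp only [Finset.sum_ite_eq', Finset.mem_univ, if_true]
    linarith [Real.add_one_le_exp (-((p i + p j) / 2))]
  have hpy0 : 0 ≤ ∑ x, p x * y x := by
    refine Finset.sum_nonneg fun x _ => mul_nonneg (hp x) ?_
    simp only [hy]
    positivity
  calc multiPr k h p {ω | ((cnt ω i + cnt ω j : ℕ) : ℝ) < m₀}
      ≤ ∑ ω : Fin h → Fin k, Real.exp m₀ * ∏ l, p (ω l) * y (ω l) := by
        refine Finset.sum_le_sum fun ω _ => ?_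
        have hw : 0 ≤ ∏ l, p (ω l) := Finset.prod_nonneg fun _ _ => hp _
        rw [Finset.prod_mul_distrib, hyprod, Set.indicator_apply]
        split_ifs with hω
        · have h1 : 1 ≤ Real.exp m₀ * e ^ (cnt ω i + cnt ω j) := by
            rw [he, ← Real.exp_nat_mul, ← Real.exp_add]
            apply Real.one_le_exp
            rw [Set.mem_ofPred_eq] at hω
            linarith
          nlinarith
        · positivity
    _ = Real.exp m₀ * (∑ x, p x * y x) ^ h := by
        rw [← Finset.mul_sum, sum_weight_eq_prod fun x => p x * y x]
    _ ≤ Real.exp m₀ * Real.exp (-((p i + p j) / 2)) ^ h := by gcongr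
    _ = Real.exp (m₀ - h * (p i + p j) / 2) := by
        rw [← Real.exp_nat_mul, ← Real.exp_add]
        congr 1
        ring

lemma cnt_comp_perm {k h : ℕ} (σ : Equiv.Perm (Fin k)) (ω : Fin h → Fin k) (x : Fin k) :
    cnt (σ ∘ ω) (σ x) = cnt ω x := by
  simp [cnt]

/-- A likelier opinion is likelier to be among the most sampled opinions. -/
lemma multiPr_Wties_le {k h : ℕ} {p : Fin k → ℝ} (hp : ∀ i, 0 ≤ p i) {i j : Fin k}
    (hji : p j ≤ p i) : multiPr k h p (Wties k h j) ≤ multiPr k h p (Wties k h i) := by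
  classical
  rcases eq_or_ne i j with rfl | hij
  · exact le_rfl
  have hcomp : Function.Bijective fun ω : Fin h → Fin k => Equiv.swap i j ∘ ω :=
    (Equiv.arrowCongr (Equiv.refl (Fin h)) (Equiv.swap i j)).bijective
  have e : multiPr k h p (Wties k h i) = ∑ ω : Fin h → Fin k,
      (Wties k h i).indicator (fun ω => ∏ l, p (ω l)) (Equiv.swap i j ∘ ω) :=
    (hcomp.sum_comp _).symm
  rw [e]
  refine Finset.sum_le_sum fun ω _ => ?_
  by_cases hω : ω ∈ Wties k h j
  · have hci : cnt (Equiv.swap i j ∘ ω) i = cnt ω j := by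
      simpa using cnt_comp_perm (Equiv.swap i j) ω j
    have hcj : cnt (Equiv.swap i j ∘ ω) j = cnt ω i := by
      simpa using cnt_comp_perm (Equiv.swap i j) ω i
    have hcx : ∀ x, x ≠ i → x ≠ j → cnt (Equiv.swap i j ∘ ω) x = cnt ω x := by
      intro x hxi hxj
      simpa [Equiv.swap_apply_of_ne_of_ne hxi hxj] using cnt_comp_perm (Equiv.swap i j) ω x
    have hmem : Equiv.swap i j ∘ ω ∈ Wties k h i := by
      intro x hxi
      rw [hci]
      by_cases hxj : x = j
      · rw [hxj, hcj]
        exact hω i hij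
      · rw [hcx x hxi hxj]
        exact hω x hxj
    have hrest : ∏ l with (Equiv.swap i j ∘ ω) l ≠ i ∧ (Equiv.swap i j ∘ ω) l ≠ j,
        p ((Equiv.swap i j ∘ ω) l) = ∏ l with ω l ≠ i ∧ ω l ≠ j, p (ω l) := by
      refine Finset.prod_congr (Finset.filter_congr fun l _ => ?_) fun l hl => ?_
      · simp only [Function.comp_apply, ne_eq, Equiv.swap_apply_eq_iff, Equiv.swap_apply_left,
          Equiv.swap_apply_right]
        exact and_comm
      · have := (Finset.mem_filter.mp hl).2
        simp [Equiv.swap_apply_of_ne_of_ne this.1 this.2]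
    rw [Set.indicator_of_mem hω, Set.indicator_of_mem hmem, prod_weight_eq p hij,
      prod_weight_eq p hij, hrest, hci, hcj]
    refine mul_le_mul_of_nonneg_right ?_ (Finset.prod_nonneg fun _ _ => hp _)
    obtain ⟨d, hd⟩ := Nat.exists_eq_add_of_le (hω i hij)
    have hpow : p j ^ d ≤ p i ^ d := pow_le_pow_left₀ (hp j) hji d
    have h0 : 0 ≤ p i ^ cnt ω i * p j ^ cnt ω i := mul_nonneg (pow_nonneg (hp i) _)
      (pow_nonneg (hp j) _)
    rw [hd, pow_add, pow_add]
    linarith [mul_le_mul_of_nonneg_left hpow h0]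
  · rw [Set.indicator_of_notMem hω]
    exact Set.indicator_nonneg (fun _ _ => Finset.prod_nonneg fun _ _ => hp _) _

lemma one_le_mul_multiPr_Wties {k h : ℕ} {p : Fin k → ℝ} (hp : ∀ i, 0 ≤ p i)
    (hsum : ∑ i, p i = 1) {i : Fin k} (hi : ∀ j, p j ≤ p i) :
    1 ≤ k * multiPr k h p (Wties k h i) := by
  have hk : (Finset.univ : Finset (Fin k)).Nonempty := ⟨i, Finset.mem_univ i⟩
  calc (1 : ℝ) = multiPr k h p Set.univ := (multiPr_univ hsum).symm
    _ ≤ ∑ j, multiPr k h p (Wties k h j) := by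
        unfold multiPr
        rw [Finset.sum_comm]
        refine Finset.sum_le_sum fun ω _ => ?_
        obtain ⟨j, -, hj⟩ := Finset.exists_max_image Finset.univ (cnt ω) hk
        have hmem : ω ∈ Wties k h j := fun x _ => hj x (Finset.mem_univ x)
        have hnn : ∀ x ∈ Finset.univ,
            0 ≤ (Wties k h x).indicator (fun ω => ∏ l, p (ω l)) ω := fun x _ =>
          Set.indicator_nonneg (fun _ _ => Finset.prod_nonneg fun _ _ => hp _) _
        refine le_trans ?_ (Finset.single_le_sum hnn (Finset.mem_univ j))
        rw [Set.indicator_of_mem hmem, Set.indicator_of_mem (Set.mem_univ ω)]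
    _ ≤ ∑ _j : Fin k, multiPr k h p (Wties k h i) :=
        Finset.sum_le_sum fun j _ => multiPr_Wties_le hp (hi j)
    _ = k * multiPr k h p (Wties k h i) := by simp

lemma update_mem_Wstrict {k h : ℕ} {i : Fin k} {ω : Fin h → Fin k} (hω : ω ∈ Wties k h i)
    {l : Fin h} (hl : ω l ≠ i) : Function.update ω l i ∈ Wstrict k h i := by
  intro x hx
  have h1 : cnt (Function.update ω l i) x ≤ cnt ω x := by
    refine Finset.card_le_card fun l' hl' => ?_
    simp only [Finset.mem_filter, Finset.mem_univ, true_and] at hl' ⊢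
    rcases eq_or_ne l' l with rfl | hne
    · rw [Function.update_self] at hl'
      exact absurd hl'.symm hx
    · rwa [Function.update_of_ne hne] at hl'
  have h2 : cnt ω i < cnt (Function.update ω l i) i := by
    refine Finset.card_lt_card (Finset.ssubset_iff_of_subset ?_ |>.mpr ⟨l, ?_, ?_⟩)
    · intro l' hl'
      simp only [Finset.mem_filter, Finset.mem_univ, true_and] at hl' ⊢
      rw [Function.update_of_ne (by rintro rfl; exact hl hl'), hl']
    · simp
    · simpa using hl
  exact (h1.trans (hω x hx)).trans_lt h2

/-- Resampling one trial as `i` turns a tie into a strict win. -/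
lemma mul_multiPr_Wties_ne_le {k h : ℕ} {p : Fin k → ℝ} (hp : ∀ i, 0 ≤ p i)
    (hsum : ∑ i, p i = 1) (i : Fin k) (l : Fin h) :
    p i * multiPr k h p (Wties k h i ∩ {ω | ω l ≠ i}) ≤ multiPr k h p (Wstrict k h i) := by
  classical
  have hw : ∀ ω : Fin h → Fin k, 0 ≤ (Wstrict k h i).indicator (fun ω => ∏ l, p (ω l)) ω :=
    fun ω => Set.indicator_nonneg (fun _ _ => Finset.prod_nonneg fun _ _ => hp _) _
  have hpoint : ∀ ω : Fin h → Fin k,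
      p i * (Wties k h i ∩ {ω | ω l ≠ i}).indicator (fun ω => ∏ l, p (ω l)) ω ≤
      p (ω l) * (Wstrict k h i).indicator (fun ω => ∏ l, p (ω l)) (Function.update ω l i) := by
    intro ω
    by_cases hω : ω ∈ Wties k h i ∩ {ω | ω l ≠ i}
    · rw [Set.indicator_of_mem hω, Set.indicator_of_mem (update_mem_Wstrict hω.1 hω.2),
        ← Finset.mul_prod_erase _ _ (Finset.mem_univ l),
        ← Finset.mul_prod_erase _ (fun x => p (Function.update ω l i x)) (Finset.mem_univ l),
        Function.update_self]
      refine le_of_eq ?_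
      rw [mul_left_comm]
      congr 2
      refine Finset.prod_congr rfl fun x hx => ?_
      rw [Function.update_of_ne (Finset.ne_of_mem_erase hx)]
    · rw [Set.indicator_of_notMem hω, mul_zero]
      exact mul_nonneg (hp _) (hw _)
  have hfib : ∀ c : Fin k, ∑ ω : Fin h → Fin k with ω l = c,
      (Wstrict k h i).indicator (fun ω => ∏ l, p (ω l)) (Function.update ω l i) ≤
      multiPr k h p (Wstrict k h i) := by
    intro c
    rw [← Finset.sum_image (f := (Wstrict k h i).indicator fun ω => ∏ l, p (ω l))
      (g := fun ω => Function.update ω l i)]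
    · exact Finset.sum_le_sum_of_subset_of_nonneg (Finset.subset_univ _) fun ω _ _ => hw ω
    · intro ω hω ω' hω' heq
      simp only [Finset.coe_filter, Finset.mem_univ, true_and, Set.mem_ofPred_eq] at hω hω'
      funext x
      rcases eq_or_ne x l with rfl | hx
      · rw [hω, hω']
      · simpa [Function.update_of_ne hx] using congrFun heq x
  calc p i * multiPr k h p (Wties k h i ∩ {ω | ω l ≠ i})
      ≤ ∑ ω : Fin h → Fin k, p (ω l) *
          (Wstrict k h i).indicator (fun ω => ∏ l, p (ω l)) (Function.update ω l i) := by
        unfold multiPr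
        rw [Finset.mul_sum]
        exact Finset.sum_le_sum fun ω _ => hpoint ω
    _ = ∑ c, p c * ∑ ω : Fin h → Fin k with ω l = c,
          (Wstrict k h i).indicator (fun ω => ∏ l, p (ω l)) (Function.update ω l i) := by
        rw [← Finset.sum_fiberwise Finset.univ (fun ω : Fin h → Fin k => ω l)]
        refine Finset.sum_congr rfl fun c _ => ?_
        rw [Finset.mul_sum]
        refine Finset.sum_congr rfl fun ω hω => ?_
        rw [(Finset.mem_filter.mp hω).2]
    _ ≤ ∑ c, p c * multiPr k h p (Wstrict k h i) :=
        Finset.sum_le_sum fun c _ => mul_le_mul_of_nonneg_left (hfib c) (hp c)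
    _ = multiPr k h p (Wstrict k h i) := by rw [← Finset.sum_mul, hsum, one_mul]

lemma mul_multiPr_Wties_le {k h : ℕ} (hh : 1 ≤ h) {p : Fin k → ℝ} (hp : ∀ i, 0 ≤ p i)
    (hsum : ∑ i, p i = 1) (i : Fin k) :
    p i * multiPr k h p (Wties k h i) ≤ (p i + h) * multiPr k h p (Wstrict k h i) := by
  have hcover : multiPr k h p (Wties k h i) ≤ multiPr k h p (Wstrict k h i) +
      ∑ l, multiPr k h p (Wties k h i ∩ {ω | ω l ≠ i}) := by
    unfold multiPr
    rw [Finset.sum_comm, ← Finset.sum_add_distrib]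
    refine Finset.sum_le_sum fun ω _ => ?_
    have hnn : ∀ A : Set (Fin h → Fin k), 0 ≤ A.indicator (fun ω => ∏ l, p (ω l)) ω :=
      fun A => Set.indicator_nonneg (fun _ _ => Finset.prod_nonneg fun _ _ => hp _) _
    by_cases hω : ω ∈ Wties k h i
    · by_cases hl : ∃ l, ω l ≠ i
      · obtain ⟨l, hl⟩ := hl
        have hmem : ω ∈ Wties k h i ∩ {ω | ω l ≠ i} := ⟨hω, hl⟩
        have := Finset.single_le_sum
          (f := fun l => (Wties k h i ∩ {ω | ω l ≠ i}).indicator (fun ω => ∏ l, p (ω l)) ω)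
          (fun l _ => hnn _) (Finset.mem_univ l)
        simp only [Set.indicator_of_mem hmem] at this
        rw [Set.indicator_of_mem hω]
        exact this.trans (le_add_of_nonneg_left (hnn _))
      · push Not at hl
        have hmem : ω ∈ Wstrict k h i := by
          intro x hx
          have : 0 < h := hh
          simpa [cnt, hl, hx.symm] using this
        rw [Set.indicator_of_mem hω, Set.indicator_of_mem hmem]
        exact le_add_of_nonneg_right (Finset.sum_nonneg fun _ _ => hnn _)
    · rw [Set.indicator_of_notMem hω]
      exact add_nonneg (hnn _) (Finset.sum_nonneg fun _ _ => hnn _)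
  calc p i * multiPr k h p (Wties k h i)
      ≤ p i * multiPr k h p (Wstrict k h i) +
          ∑ l, p i * multiPr k h p (Wties k h i ∩ {ω | ω l ≠ i}) := by
        rw [← Finset.mul_sum, ← mul_add]
        exact mul_le_mul_of_nonneg_left hcover (hp i)
    _ ≤ p i * multiPr k h p (Wstrict k h i) + ∑ _l : Fin h, multiPr k h p (Wstrict k h i) := by
        gcongr with l
        exact mul_multiPr_Wties_ne_le hp hsum i l
    _ = (p i + h) * multiPr k h p (Wstrict k h i) := by
        simp only [Finset.sum_const, Finset.card_univ, Fintype.card_fin, nsmul_eq_mul]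
        ring

/-- The most likely opinion wins strictly with at least polynomially small probability. -/
lemma inv_le_multiPr_Wstrict {n k h : ℕ} (hh : 1 ≤ h) (hkn : k ≤ n) {p : Fin k → ℝ}
    (hp : ∀ i, 0 ≤ p i) (hsum : ∑ i, p i = 1) {i : Fin k} (hi : ∀ j, p j ≤ p i) :
    1 ≤ (n : ℝ) ^ 3 * (1 + h * p i) * multiPr k h p (Wstrict k h i) := by
  have hP := multiPr_nonneg hp (Wstrict k h i)
  have hkn' : (k : ℝ) ≤ n := by exact_mod_cast hkn
  have hnp : 1 ≤ (n : ℝ) * p i := by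
    have : ∑ j, p j ≤ ∑ _j : Fin k, p i := Finset.sum_le_sum fun j _ => hi j
    rw [hsum, Finset.sum_const, Finset.card_univ, Fintype.card_fin, nsmul_eq_mul] at this
    exact this.trans (mul_le_mul_of_nonneg_right hkn' (hp i))
  have hpi : 0 < p i := by
    rcases (hp i).eq_or_lt with h0 | h0
    · rw [← h0] at hnp
      norm_num at hnp
    · exact h0
  have h1 := one_le_mul_multiPr_Wties (h := h) hp hsum hi
  have h2 := mul_multiPr_Wties_le hh hp hsum i
  set P := multiPr k h p (Wstrict k h i)
  have hT := multiPr_nonneg hp (Wties k h i)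
  set T := multiPr k h p (Wties k h i)
  have h3 : p i ≤ n * ((p i + h) * P) := by
    calc p i = p i * 1 := (mul_one _).symm
      _ ≤ p i * (n * T) := by
          gcongr
          exact h1.trans (mul_le_mul_of_nonneg_right hkn' hT)
      _ = n * (p i * T) := by ring
      _ ≤ _ := by gcongr
  have h4 : p i + h ≤ (n : ℝ) ^ 2 * p i * (1 + h * p i) := by
    have hsq : 1 ≤ ((n : ℝ) * p i) ^ 2 := one_le_pow₀ hnp
    have hn1 : (1 : ℝ) ≤ (n : ℝ) ^ 2 := by
      have : 0 < n := by
        rcases Nat.eq_zero_or_pos n with rfl | h'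
        · norm_num at hnp
        · exact h'
      have : (1 : ℝ) ≤ n := by exact_mod_cast this
      exact one_le_pow₀ this
    have ha := mul_le_mul_of_nonneg_right hn1 hpi.le
    have hb := mul_le_mul_of_nonneg_left hsq (Nat.cast_nonneg (α := ℝ) h)
    linarith
  refine le_of_mul_le_mul_left ?_ hpi
  calc p i * 1 ≤ n * ((p i + h) * P) := by rw [mul_one]; exact h3
    _ ≤ n * ((n : ℝ) ^ 2 * p i * (1 + h * p i) * P) := by gcongr
    _ = _ := by ring

lemma exp_neg_le_of_log_le {n : ℕ} (hn : 2 ≤ n) {x : ℝ} (hx : 324 * Real.log n ≤ x) :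
    (n : ℝ) ^ 3 * (1 + x) * (2 * Real.exp (-x / 4)) ≤ 1 := by
  have hn2 : (2 : ℝ) ≤ n := by exact_mod_cast hn
  have hlog : Real.log 2 ≤ Real.log n := Real.log_le_log (by norm_num) hn2
  have hx0 : 200 ≤ x := by linarith [Real.log_two_gt_d9]
  have hnx : (n : ℝ) ≤ Real.exp (x / 324) := by
    rw [← Real.log_le_iff_le_exp (by linarith)]
    linarith
  have hlin : 2 * (1 + x) ≤ Real.exp (x / 5) := by
    refine le_trans ?_ (Real.quadratic_le_exp_of_nonneg (by linarith))
    nlinarith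
  calc (n : ℝ) ^ 3 * (1 + x) * (2 * Real.exp (-x / 4))
      = (n : ℝ) ^ 3 * (2 * (1 + x)) * Real.exp (-x / 4) := by ring
    _ ≤ Real.exp (x / 324) ^ 3 * Real.exp (x / 5) * Real.exp (-x / 4) := by gcongr
    _ = Real.exp (3 * (x / 324) + x / 5 + -x / 4) := by
        rw [Real.exp_add, Real.exp_add, ← Real.exp_nat_mul]
        norm_num
    _ ≤ 1 := by
        rw [Real.exp_le_one_iff]
        linarith

/-- there is a constant `C > 0` such that for `n` large enough,
`k ≤ n`, `p_1 ≥ … ≥ p_k` and `h·p_1 ≥ 324·log n`, the conditional winning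
probabilities given `W_{1,2,strict}` satisfy
`Pr(W_1 | W_{1,2,strict}) - Pr(W_2 | W_{1,2,strict}) ≥
  C·min((p_1 - p_2)·√h / √(2(p_1 + p_2)), 1)`. -/
theorem conditional_win_diff_lower_bound :
    ∃ C : ℝ, 0 < C ∧
      ∃ n0 : ℕ, ∀ (n k h : ℕ), n0 ≤ n → ∀ (hk : 2 ≤ k), 1 ≤ h → k ≤ n →
        ∀ p : Fin k → ℝ, (∀ i, 0 ≤ p i) → ∑ i, p i = 1 →
          (∀ i j : Fin k, i ≤ j → p j ≤ p i) →
          324 * Real.log n ≤ (h : ℝ) * p (o₁ k hk) →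
          C * min ((p (o₁ k hk) - p (o₂ k hk)) * Real.sqrt h /
              Real.sqrt (2 * (p (o₁ k hk) + p (o₂ k hk)))) 1 ≤
            winPrOn k h p (W12strict k h (o₁ k hk) (o₂ k hk)) (o₁ k hk) /
                multiPr k h p (W12strict k h (o₁ k hk) (o₂ k hk)) -
              winPrOn k h p (W12strict k h (o₁ k hk) (o₂ k hk)) (o₂ k hk) /
                multiPr k h p (W12strict k h (o₁ k hk) (o₂ k hk)) := by
  refine ⟨1 / 64, by norm_num, 2, fun n k h hn hk hh hkn p hp hsum hmono hlog => ?_⟩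
  have hij : o₁ k hk ≠ o₂ k hk := by simp [o₁, o₂]
  have hmax : ∀ j, p j ≤ p (o₁ k hk) := fun j => hmono _ _ (Nat.zero_le _)
  rw [winPrOn_W12strict, W12strict_comm, winPrOn_W12strict, W12strict_comm]
  generalize o₁ k hk = i at *
  generalize o₂ k hk = j at *
  have hji := hmax j
  have hpos := inv_le_multiPr_Wstrict hh hkn hp hsum hmax
  have hexp := exp_neg_le_of_log_le hn hlog
  have hn2 : (2 : ℝ) ≤ n := by exact_mod_cast hn
  have hx : 0 < (h : ℝ) * p i := by
    linarith [Real.log_pos (show (1 : ℝ) < n by linarith)]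
  have hh0 : (0 : ℝ) ≤ h := Nat.cast_nonneg h
  have hpi : 0 < p i := pos_of_mul_pos_right hx hh0
  have hs : 0 < p i + p j := by linarith [hp j]
  set s := p i + p j with hs_def
  have htail : multiPr k h p {ω | ((cnt ω i + cnt ω j : ℕ) : ℝ) < s * h / 4} ≤
      Real.exp (-(h * p i) / 4) := by
    refine (multiPr_cnt_add_cnt_lt_le hp hsum hij _).trans ?_
    rw [Real.exp_le_exp]
    nlinarith [mul_nonneg hh0 (hp j)]
  have hW : 2 * Real.exp (-(h * p i) / 4) ≤ multiPr k h p (Wstrict k h i) := by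
    refine le_of_mul_le_mul_left (hexp.trans hpos) ?_
    positivity
  have hWpos : 0 < multiPr k h p (Wstrict k h i) :=
    lt_of_lt_of_le (by positivity) hW
  have h12 := multiPr_W12strict (h := h) p hij
  have hWj := multiPr_nonneg hp (Wstrict k h j)
  have hnn : 0 ≤ (p i - p j) / s := div_nonneg (by linarith) hs.le
  have hmain := multiPr_Wstrict_sub_lower (h := h) hp hij hji hs (s * h / 4)
    (δ := min ((p i - p j) / s * Real.sqrt (s * h / 4)) 1 / 16) (by positivity) le_rfl
  have hcmp : 1 / 32 * min ((p i - p j) * Real.sqrt h / Real.sqrt (2 * s)) 1 ≤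
      min ((p i - p j) / s * Real.sqrt (s * h / 4)) 1 / 16 := by
    have hq : (p i - p j) * Real.sqrt h / Real.sqrt (2 * s) ≤
        2 * ((p i - p j) / s * Real.sqrt (s * h / 4)) := by
      have h1 : Real.sqrt (s * h / 4) = Real.sqrt s * Real.sqrt h / 2 := by
        rw [Real.sqrt_div (by positivity), Real.sqrt_mul hs.le,
          show (4 : ℝ) = 2 ^ 2 by norm_num, Real.sqrt_sq (by norm_num)]
      have h2 : 2 * ((p i - p j) / s * Real.sqrt (s * h / 4)) =
          (p i - p j) * Real.sqrt h / Real.sqrt s := by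
        rw [h1]
        have hss : Real.sqrt s ≠ 0 := (Real.sqrt_pos.mpr hs).ne'
        field_simp
        rw [Real.sq_sqrt hs.le]
      rw [h2]
      have : 0 ≤ p i - p j := by linarith
      gcongr
      linarith
    rcases le_total ((p i - p j) / s * Real.sqrt (s * h / 4)) 1 with hle | hle
    · rw [min_eq_left hle]
      linarith [min_le_left ((p i - p j) * Real.sqrt h / Real.sqrt (2 * s)) 1]
    · rw [min_eq_right hle]
      linarith [min_le_right ((p i - p j) * Real.sqrt h / Real.sqrt (2 * s)) 1]
  have hmin0 : 0 ≤ min ((p i - p j) * Real.sqrt h / Real.sqrt (2 * s)) 1 := by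
    have : 0 ≤ p i - p j := by linarith
    positivity
  rw [← sub_div, le_div_iff₀ (by linarith)]
  refine le_trans ?_ hmain
  have hhalf : multiPr k h p (W12strict k h i j) / 2 ≤ multiPr k h p (W12strict k h i j) -
      multiPr k h p {ω | ((cnt ω i + cnt ω j : ℕ) : ℝ) < s * h / 4} := by linarith
  calc _ = 1 / 32 * min ((p i - p j) * Real.sqrt h / Real.sqrt (2 * s)) 1 *
        (multiPr k h p (W12strict k h i j) / 2) := by ring
    _ ≤ _ := mul_le_mul hcmp hhalf (by linarith) (by positivity)
end
end
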